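/- arXiv:0710.0642 — 2 statements merged into one kernel-verified Lean document; each statement's English description precedes it below -/
import Mathlib

section
/- There is an absolute constant C > 0 with the following property. Let A ⊆ ℤ be a finite nonempty set and K ≥ 2 a real number with |A + A| ≤ K·|A|. Then there exist a natural number d, an integer a, integers x₁, …, x_d and positive integers L₁, …, L_d such that A ⊆ P := {a + l₁x₁ + ⋯ + l_d x_d : 0 ≤ lᵢ < Lᵢ for each i}, with d ≤ C·K^{7/4}·(log K)³ and L₁·L₂⋯L_d ≤ exp(C·K^{7/4}·(log K)³)·|A|. -/
open scoped Pointwise BigOperators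

lemma proj_decomp {E : Type} [NormedAddCommGroup E] [InnerProductSpace ℝ E]
    [FiniteDimensional ℝ E] (v : E) (u : E) :
    ∃ c : ℝ, u = (((ℝ ∙ v)ᗮ).orthogonalProjectionOnto u : E) + c • v ∧
      ∀ t : ℝ, ‖u + t • v‖ ^ 2 =
        ‖((ℝ ∙ v)ᗮ).orthogonalProjectionOnto u‖ ^ 2 + (c + t) ^ 2 * ‖v‖ ^ 2 := by
  set w := ((ℝ ∙ v)ᗮ).orthogonalProjectionOnto u with hw
  have h1 : u - (w : E) ∈ (ℝ ∙ v) := by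
    have := Submodule.sub_starProjection_mem_orthogonal (K := (ℝ ∙ v)ᗮ) u
    rw [Submodule.orthogonal_orthogonal] at this
    simpa [hw] using this
  obtain ⟨c, hc⟩ := Submodule.mem_span_singleton.1 h1
  have hu : u = (w : E) + c • v := by rw [hc]; abel
  refine ⟨c, hu, fun t => ?_⟩
  have horth : inner ℝ (w : E) ((c + t) • v) = 0 := by
    rw [inner_smul_right]
    have := Submodule.mem_orthogonal_singleton_iff_inner_left.1 w.2
    rw [this]; simp
  have e : u + t • v = (w : E) + (c + t) • v := by
    conv_lhs => rw [hu]
    rw [add_smul]; abel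
  rw [e, sq, norm_add_sq_eq_norm_sq_add_norm_sq_of_inner_eq_zero _ _ horth, norm_smul]
  simp only [Real.norm_eq_abs, Submodule.coe_norm]
  rw [show |c + t| * ‖v‖ * (|c + t| * ‖v‖) = |c+t|^2 * ‖v‖^2 by ring, sq_abs]
  ring

lemma lattice_gap : ∀ (n : ℕ) (E : Type) [NormedAddCommGroup E] [InnerProductSpace ℝ E]
    [FiniteDimensional ℝ E], Module.finrank ℝ E = n → ∀ (Γ : AddSubgroup E)
    (_ : ∀ r : ℝ, {v | v ∈ Γ ∧ ‖v‖ ≤ r}.Finite) (R : ℝ) (_ : 0 ≤ R),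
    ∃ r ≤ n, ∃ (v : Fin r → E) (L : Fin r → ℕ), (∀ i, v i ∈ Γ) ∧ (∀ i, 0 < L i) ∧
      (∀ i, (L i : ℝ) * ‖v i‖ ≤ 2 ^ n * R) ∧ (∀ l : Fin r → ℤ, ∑ i, l i • v i = 0 → l = 0) ∧
      {v | v ∈ Γ ∧ ‖v‖ ≤ R}.ncard ≤ 8 ^ n * ∏ i, L i := by
  intro n
  induction n with
  | zero =>
    intro E _ _ _ hE Γ hΓ R hR
    refine ⟨0, le_rfl, Fin.elim0, Fin.elim0, fun i => i.elim0, fun i => i.elim0,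
      fun i => i.elim0, fun l _ => Subsingleton.elim _ _, ?_⟩
    have := Module.finrank_zero_iff.1 hE
    simp only [pow_zero, Finset.univ_eq_empty, Finset.prod_empty, mul_one]
    exact Set.ncard_le_one_of_subsingleton _
  | succ n ih =>
    intro E _ _ _ hE Γ hΓ R hR
    classical
    by_cases htriv : ∀ v ∈ Γ, ‖v‖ ≤ R → v = 0
    · refine ⟨0, by omega, Fin.elim0, Fin.elim0, fun i => i.elim0, fun i => i.elim0,
        fun i => i.elim0, fun l _ => Subsingleton.elim _ _, ?_⟩
      have : {v | v ∈ Γ ∧ ‖v‖ ≤ R} ⊆ {0} := fun v hv => htriv v hv.1 hv.2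
      have := Set.ncard_le_ncard this
      simp only [Set.ncard_singleton] at this
      simp only [Finset.univ_eq_empty, Finset.prod_empty, mul_one]
      exact this.trans (Nat.one_le_pow _ _ (by norm_num))
    push Not at htriv
    obtain ⟨u0, hu0, hu0R, hu00⟩ := htriv
    -- shortest vector
    obtain ⟨v, ⟨⟨hvΓ, hvR⟩, hv0⟩, hvmin⟩ : ∃ v ∈ ({v | v ∈ Γ ∧ ‖v‖ ≤ R} \ {0}),
        ∀ w ∈ ({v | v ∈ Γ ∧ ‖v‖ ≤ R} \ {0}), ‖v‖ ≤ ‖w‖ := by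
      have := Set.exists_min_image ({v | v ∈ Γ ∧ ‖v‖ ≤ R} \ {0}) (fun v => ‖v‖)
        ((hΓ R).subset Set.sdiff_subset) ⟨u0, ⟨hu0, hu0R⟩, hu00⟩
      exact this
    have hv0' : v ≠ 0 := hv0
    have hvpos : 0 < ‖v‖ := norm_pos_iff.2 hv0'
    have hmin : ∀ w ∈ Γ, w ≠ 0 → ‖v‖ ≤ ‖w‖ := by
      intro w hw hw0
      by_cases h : ‖w‖ ≤ R
      · exact hvmin w ⟨⟨hw, h⟩, hw0⟩
      · linarith
    set K := (ℝ ∙ v)ᗮ with hK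
    set π : E →L[ℝ] K := K.orthogonalProjectionOnto with hπ
    have hfK : Module.finrank ℝ K = n := by
      haveI : Fact (Module.finrank ℝ E = n + 1) := ⟨hE⟩
      exact Submodule.finrank_orthogonal_span_singleton hv0'
    -- lifting
    have hlift : ∀ u ∈ Γ, ∃ u' ∈ Γ, π u' = π u ∧ ‖u'‖ ≤ 2 * ‖π u‖ := by
      intro u hu
      obtain ⟨c, hc, hn⟩ := proj_decomp v u
      have hπv : π v = 0 := by
        rw [hπ, Submodule.orthogonalProjectionOnto_eq_zero_iff, hK, Submodule.orthogonal_orthogonal]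
        exact Submodule.mem_span_singleton_self v
      refine ⟨u + (-round c : ℤ) • v, Γ.add_mem hu (Γ.zsmul_mem hvΓ _), ?_, ?_⟩
      · rw [map_add, map_zsmul, hπv]; simp
      · have h1 := hn ((-round c : ℤ) : ℝ)
        rw [Int.cast_smul_eq_zsmul] at h1
        have h2 : (c + ((-round c : ℤ) : ℝ)) ^ 2 ≤ 1 / 4 := by
          have := abs_sub_round c
          push_cast
          have h3 := abs_le.1 this
          nlinarith [h3.1, h3.2]
        by_cases h0 : u + (-round c : ℤ) • v = 0
        · rw [h0]; simp
        · have h3 := hmin _ (Γ.add_mem hu (Γ.zsmul_mem hvΓ (-round c))) h0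
          change _ = ‖π u‖ ^ 2 + _ at h1
          have h4 : ‖v‖ ^ 2 ≤ ‖u + (-round c : ℤ) • v‖ ^ 2 := by gcongr
          have h5 : (c + ((-round c : ℤ) : ℝ)) ^ 2 * ‖v‖ ^ 2 ≤ 1 / 4 * ‖v‖ ^ 2 := by gcongr
          apply abs_le_of_sq_le_sq' _ (by positivity) |>.2
          nlinarith
    have hπv : π v = 0 := by
      rw [hπ, Submodule.orthogonalProjectionOnto_eq_zero_iff, hK, Submodule.orthogonal_orthogonal]
      exact Submodule.mem_span_singleton_self v
    set Γ' : AddSubgroup K := Γ.map π.toLinearMap.toAddMonoidHom with hΓ'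
    have hΓ'mem : ∀ w, w ∈ Γ' ↔ ∃ u ∈ Γ, π u = w := by
      intro w; simp [hΓ', AddSubgroup.mem_map]
    have hfin' : ∀ r : ℝ, {w | w ∈ Γ' ∧ ‖w‖ ≤ r}.Finite := by
      intro r
      refine ((hΓ (2 * r)).image π).subset ?_
      rintro w ⟨hw, hwr⟩
      obtain ⟨u, hu, rfl⟩ := (hΓ'mem w).1 hw
      obtain ⟨u', hu', he, hn⟩ := hlift u hu
      exact ⟨u', ⟨hu', by linarith⟩, he⟩
    obtain ⟨r, hr, w, L, hwΓ, hL, hLw, hind, hcard⟩ := ih K hfK Γ' hfin' R hR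
    have : ∀ i, ∃ u' ∈ Γ, π u' = w i ∧ ‖u'‖ ≤ 2 * ‖w i‖ := by
      intro i
      obtain ⟨u, hu, he⟩ := (hΓ'mem _).1 (hwΓ i)
      rw [← he]
      exact hlift u hu
    choose v' hv'Γ hv'π hv'n using this
    set L1 : ℕ := ⌊R / ‖v‖⌋₊ with hL1
    have hL1pos : 0 < L1 := Nat.floor_pos.2 (by rwa [one_le_div hvpos])
    have hL1le : (L1 : ℝ) * ‖v‖ ≤ R := by
      rw [← le_div_iff₀ hvpos]
      exact Nat.floor_le (by positivity)
    have hL1lt : R < (L1 + 1) * ‖v‖ := by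
      rw [← div_lt_iff₀ hvpos]
      exact Nat.lt_floor_add_one _
    refine ⟨r + 1, by omega, Fin.cons v v', Fin.cons L1 L, ?_, ?_, ?_, ?_, ?_⟩
    · intro i; refine Fin.cases ?_ (fun i => ?_) i <;> simp [hvΓ, hv'Γ]
    · intro i; refine Fin.cases ?_ (fun i => ?_) i <;> simp [hL1pos, hL]
    · intro i
      refine Fin.cases ?_ (fun i => ?_) i
      · simp only [Fin.cons_zero]
        have : (1 : ℝ) ≤ 2 ^ (n + 1) := one_le_pow₀ (by norm_num)
        nlinarith
      · simp only [Fin.cons_succ]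
        have := hLw i
        have h2 := mul_le_mul_of_nonneg_left (hv'n i) (Nat.cast_nonneg (α := ℝ) (L i))
        rw [pow_succ]
        nlinarith
    · intro l hl
      rw [Fin.sum_univ_succ] at hl
      simp only [Fin.cons_zero, Fin.cons_succ] at hl
      have h1 := congrArg π hl
      rw [map_add, map_zsmul, hπv, map_sum] at h1
      simp only [map_zsmul, hv'π, smul_zero, zero_add, map_zero] at h1
      have h2 := hind (fun i => l i.succ) h1
      have h3 : ∀ i : Fin r, l i.succ = 0 := fun i => congrFun h2 i
      simp only [h3, zero_smul, Finset.sum_const_zero, add_zero] at hl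
      have h4 : l 0 = 0 := by
        rw [← Int.cast_smul_eq_zsmul ℝ] at hl
        rcases smul_eq_zero.1 hl with h | h
        · exact_mod_cast h
        · exact absurd h hv0'
      funext i
      refine Fin.cases h4 h3 i
    · rw [Fin.prod_univ_succ]
      simp only [Fin.cons_zero, Fin.cons_succ]
      set S := (hΓ R).toFinset with hS
      have hS' : {v | v ∈ Γ ∧ ‖v‖ ≤ R}.ncard = S.card := Set.ncard_eq_toFinset_card _ (hΓ R)
      rw [hS']
      have himg : (S.image π).card ≤ {v | v ∈ Γ' ∧ ‖v‖ ≤ R}.ncard := by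
        rw [Set.ncard_eq_toFinset_card _ (hfin' R)]
        apply Finset.card_le_card
        intro x hx
        simp only [Finset.mem_image, hS, Set.Finite.mem_toFinset, Set.mem_ofPred_eq] at hx ⊢
        obtain ⟨a, ⟨ha, haR⟩, rfl⟩ := hx
        refine ⟨(hΓ'mem _).2 ⟨a, ha, rfl⟩, ?_⟩
        exact (Submodule.norm_orthogonalProjectionOnto_apply_le K a).trans haR
      have hfib : ∀ a ∈ S.image π, (S.filter (fun x => π x = a)).card ≤ 8 * L1 := by
        intro a ha
        obtain ⟨x0, hx0, rfl⟩ := Finset.mem_image.1 ha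
        simp only [hS, Set.Finite.mem_toFinset, Set.mem_ofPred_eq] at hx0
        have hsub : S.filter (fun x => π x = π x0) ⊆
            (Finset.Icc (-(2 * L1 + 1 : ℤ)) (2 * L1 + 1)).image (fun c : ℤ => x0 + c • v) := by
          intro x hx
          simp only [hS, Finset.mem_filter, Set.Finite.mem_toFinset, Set.mem_ofPred_eq] at hx
          obtain ⟨⟨hxΓ, hxR⟩, hxπ⟩ := hx
          obtain ⟨u', hu', he, hn⟩ := hlift (x - x0) (Γ.sub_mem hxΓ hx0.1)
          obtain ⟨c, hc, hn⟩ := proj_decomp v (x - x0)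
          have hz : π (x - x0) = 0 := by rw [map_sub, hxπ, sub_self]
          change x - x0 = ((π (x - x0) : K) : E) + _ at hc
          rw [hz] at hc
          simp only [ZeroMemClass.coe_zero, zero_add] at hc
          -- c is an integer
          have hcr : c = round c := by
            by_contra hne
            have h1 : (x - x0) - (round c : ℤ) • v = (c - round c) • v := by
              rw [hc, sub_smul, Int.cast_smul_eq_zsmul]
            have h2 : (x - x0) - (round c : ℤ) • v ∈ Γ :=
              Γ.sub_mem (Γ.sub_mem hxΓ hx0.1) (Γ.zsmul_mem hvΓ _)
            have h3 : (x - x0) - (round c : ℤ) • v ≠ 0 := by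
              rw [h1]; exact smul_ne_zero (sub_ne_zero.2 hne) hv0'
            have h4 := hmin _ h2 h3
            rw [h1, norm_smul, Real.norm_eq_abs] at h4
            have := abs_sub_round c
            nlinarith
          have hcn : |c| * ‖v‖ ≤ 2 * R := by
            have : ‖x - x0‖ = |c| * ‖v‖ := by rw [hc, norm_smul, Real.norm_eq_abs]
            rw [← this]
            have := norm_sub_le x x0
            linarith [hx0.2]
          have hcl : |c| < 2 * L1 + 2 := by
            by_contra hcon
            push Not at hcon
            nlinarith
          have hcl' : |round c| < 2 * L1 + 2 := by
            rw [hcr] at hcl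
            exact_mod_cast hcl
          simp only [Finset.mem_image, Finset.mem_Icc]
          refine ⟨round c, ?_, ?_⟩
          · have := abs_lt.1 hcl'
            constructor <;> omega
          · rw [← Int.cast_smul_eq_zsmul ℝ, ← hcr, ← hc]; abel
        calc _ ≤ _ := Finset.card_le_card hsub
          _ ≤ _ := Finset.card_image_le
          _ ≤ 8 * L1 := by
            rw [Int.card_Icc]; omega
      calc S.card ≤ 8 * L1 * (S.image π).card := Finset.card_le_mul_card_image S _ hfib
        _ ≤ 8 * L1 * (8 ^ n * ∏ i, L i) := by gcongr; exact himg.trans hcard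
        _ = _ := by ring

lemma eucl_norm_le {n : ℕ} (v : EuclideanSpace ℝ (Fin n)) (c : ℝ) (hc : 0 ≤ c)
    (h : ∀ i, |v i| ≤ c) : ‖v‖ ≤ n * c := by
  apply abs_le_of_sq_le_sq' _ (by positivity) |>.2
  rw [EuclideanSpace.norm_sq_eq]
  calc ∑ i, ‖v i‖ ^ 2 ≤ ∑ i : Fin n, c ^ 2 := by
        apply Finset.sum_le_sum
        intro i _
        have := h i
        rw [Real.norm_eq_abs]
        gcongr
    _ = n * c ^ 2 := by simp
    _ ≤ (n * c) ^ 2 := by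
        rw [mul_pow]
        rcases Nat.eq_zero_or_pos n with rfl | hn
        · simp
        · have : (1 : ℝ) ≤ n := by exact_mod_cast hn
          have h2 : (n : ℝ) ≤ n ^ 2 := by nlinarith
          gcongr

/-- the lattice embedding -/
noncomputable def latEmb (N : ℕ) {d : ℕ} (θ : Fin d → ℝ) :
    ℤ × (Fin d → ℤ) →+ EuclideanSpace ℝ (Fin (d + 1)) where
  toFun p := WithLp.toLp 2 (Fin.cons ((p.1 : ℝ) / N) (fun j => θ j * p.1 - p.2 j) : Fin (d + 1) → ℝ)
  map_zero' := by
    ext i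
    refine Fin.cases ?_ (fun j => ?_) i <;> simp
  map_add' := by
    intro p p'
    ext i
    refine Fin.cases ?_ (fun j => ?_) i
    · simp [add_div]
    · simp; ring

lemma latEmb_zero (N : ℕ) {d : ℕ} (θ : Fin d → ℝ) (p : ℤ × (Fin d → ℤ)) :
    latEmb N θ p 0 = (p.1 : ℝ) / N := by simp [latEmb]

lemma latEmb_succ (N : ℕ) {d : ℕ} (θ : Fin d → ℝ) (p : ℤ × (Fin d → ℤ)) (j : Fin d) :
    latEmb N θ p j.succ = θ j * p.1 - p.2 j := by simp [latEmb]

lemma bohr_gap (N : ℕ) (hN : 0 < N) (d : ℕ) (θ : Fin d → ℝ) (q : ℕ) (hq : 0 < q) (δ : ℝ)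
    (hδ : δ < 1 / 2) (hqδ : ((d : ℝ) + 1) ^ 2 * 2 ^ (d + 1) ≤ δ * q) :
    ∃ r ≤ d + 1, ∃ (x : Fin r → ℤ) (L : Fin r → ℕ), (∀ i, 0 < L i) ∧
      (∀ l : Fin r → ℕ, (∀ i, l i < L i) → ∀ j, ∃ m : ℤ,
        |θ j * ((∑ i, (l i : ℤ) * x i : ℤ) : ℝ) - m| ≤ δ) ∧
      (∀ l l' : Fin r → ℕ, (∀ i, l i < L i) → (∀ i, l' i < L i) →
        (N : ℤ) ∣ (∑ i, (l i : ℤ) * x i) - ∑ i, (l' i : ℤ) * x i → l = l') ∧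
      N ≤ (8 * q) ^ (d + 1) * ∏ i, L i := by
  classical
  have hNr : (0 : ℝ) < N := by exact_mod_cast hN
  have hqr : (0 : ℝ) < q := by exact_mod_cast hq
  set Γ : AddSubgroup (EuclideanSpace ℝ (Fin (d + 1))) := (latEmb N θ).range with hΓ
  have hfin : ∀ r : ℝ, {v | v ∈ Γ ∧ ‖v‖ ≤ r}.Finite := by
    intro r
    set a : ℤ := ⌈r * N⌉ with ha
    set b : Fin d → ℤ := fun j => ⌈|θ j| * (r * N) + r⌉ with hb
    refine ((Set.finite_Icc ((-a, -b) : ℤ × (Fin d → ℤ)) (a, b)).image (latEmb N θ)).subset ?_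
    rintro v ⟨⟨p, rfl⟩, hv⟩
    refine ⟨p, ?_, rfl⟩
    have h0 := (PiLp.norm_apply_le (latEmb N θ p) 0).trans hv
    rw [latEmb_zero, Real.norm_eq_abs, abs_div, abs_of_pos hNr, div_le_iff₀ hNr] at h0
    have hx := abs_le.1 h0
    have h1 : ∀ j, |(p.2 j : ℝ)| ≤ |θ j| * (r * N) + r := by
      intro j
      have h2 := (PiLp.norm_apply_le (latEmb N θ p) j.succ).trans hv
      rw [latEmb_succ, Real.norm_eq_abs] at h2
      have h3 : |θ j * p.1| ≤ |θ j| * (r * N) := by rw [abs_mul]; gcongr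
      have h4 : (p.2 j : ℝ) = θ j * p.1 - (θ j * p.1 - p.2 j) := by ring
      rw [h4]
      exact (abs_sub _ _).trans (add_le_add h3 h2)
    have hx1 : p.1 ≤ a := by
      have := hx.2.trans (Int.le_ceil (r * N)); exact_mod_cast this
    have hx2 : -a ≤ p.1 := by
      have : -(a : ℝ) ≤ p.1 := by linarith [hx.1, Int.le_ceil (r * N)]
      exact_mod_cast this
    have hy1 : p.2 ≤ b := fun j => by
      have := ((abs_le.1 (h1 j)).2).trans (Int.le_ceil _); exact_mod_cast this
    have hy2 : -b ≤ p.2 := fun j => by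
      have : -(b j : ℝ) ≤ p.2 j := by
        linarith [(abs_le.1 (h1 j)).1, Int.le_ceil (|θ j| * (r * N) + r)]
      exact_mod_cast this
    exact ⟨⟨hx2, hy2⟩, ⟨hx1, hy1⟩⟩
  set R : ℝ := ((d + 1 : ℕ) : ℝ) * (1 / q) with hR
  have hR0 : 0 ≤ R := by positivity
  obtain ⟨r, hr, v, L, hvΓ, hL, hLv, hind, hcard⟩ := lattice_gap (d + 1)
    (EuclideanSpace ℝ (Fin (d + 1))) (by simp) Γ hfin R hR0
  choose p hp using hvΓ
  have hbound : ∀ l : Fin r → ℕ, (∀ i, l i < L i) → ‖∑ i, (l i : ℤ) • v i‖ ≤ δ := by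
    intro l hl
    have h1 : ∀ i, ‖(l i : ℤ) • v i‖ ≤ 2 ^ (d + 1) * R := by
      intro i
      rw [← Int.cast_smul_eq_zsmul ℝ, norm_smul]
      refine le_trans ?_ (hLv i)
      have : (l i : ℝ) ≤ L i := by exact_mod_cast (hl i).le
      simp only [Int.cast_natCast, Real.norm_natCast]
      gcongr
    calc ‖∑ i, (l i : ℤ) • v i‖ ≤ ∑ i, ‖(l i : ℤ) • v i‖ := norm_sum_le _ _
      _ ≤ ∑ i : Fin r, 2 ^ (d + 1) * R := Finset.sum_le_sum fun i _ => h1 i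
      _ = r * (2 ^ (d + 1) * R) := by simp
      _ ≤ (d + 1 : ℕ) * (2 ^ (d + 1) * R) := by gcongr
      _ = (((d : ℝ) + 1) ^ 2 * 2 ^ (d + 1)) / q := by rw [hR]; push_cast; ring
      _ ≤ δ := by rwa [div_le_iff₀ hqr]
  have hsum : ∀ l : Fin r → ℕ, ∑ i, (l i : ℤ) • v i =
      latEmb N θ (∑ i, (l i : ℤ) * (p i).1, ∑ i, (l i : ℤ) • (p i).2) := by
    intro l
    have : (∑ i, (l i : ℤ) * (p i).1, ∑ i, (l i : ℤ) • (p i).2) = ∑ i, (l i : ℤ) • p i := by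
      ext <;> simp [Prod.fst_sum, Prod.snd_sum]
    rw [this, map_sum]
    simp only [map_zsmul, hp]
  refine ⟨r, hr, fun i => (p i).1, L, hL, ?_, ?_, ?_⟩
  · intro l hl j
    have h1 := hbound l hl
    rw [hsum] at h1
    have h2 := (PiLp.norm_apply_le _ j.succ).trans h1
    rw [latEmb_succ, Real.norm_eq_abs] at h2
    exact ⟨_, h2⟩
  · intro l l' hl hl' hdvd
    have h1 := hbound l hl
    have h1' := hbound l' hl'
    have heq : ∑ i, (l i : ℤ) • v i = ∑ i, (l' i : ℤ) • v i := by
      rw [hsum] at h1 h1' ⊢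
      rw [hsum]
      set X := ∑ i, (l i : ℤ) * (p i).1
      set X' := ∑ i, (l' i : ℤ) * (p i).1
      set Y := ∑ i, (l i : ℤ) • (p i).2
      set Y' := ∑ i, (l' i : ℤ) • (p i).2
      have hX : X = X' := by
        have h2 := (PiLp.norm_apply_le _ 0).trans h1
        have h3 := (PiLp.norm_apply_le _ 0).trans h1'
        rw [latEmb_zero, Real.norm_eq_abs, abs_div, abs_of_pos hNr, div_le_iff₀ hNr] at h2 h3
        have h4 : |((X - X' : ℤ) : ℝ)| < N := by
          push_cast
          refine lt_of_le_of_lt (abs_sub _ _) ?_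
          simp only at h2 h3
          nlinarith
        have h5 : |X - X'| < N := by exact_mod_cast h4
        have := Int.eq_zero_of_abs_lt_dvd hdvd h5
        omega
      have hY : Y = Y' := by
        funext j
        have h2 := (PiLp.norm_apply_le _ j.succ).trans h1
        have h3 := (PiLp.norm_apply_le _ j.succ).trans h1'
        rw [latEmb_succ, Real.norm_eq_abs] at h2 h3
        simp only [hX] at h2 h3
        have h4 : |((Y j - Y' j : ℤ) : ℝ)| < 1 := by
          push_cast
          have : (Y j : ℝ) - Y' j = (θ j * X' - Y' j) - (θ j * X' - Y j) := by ring
          rw [this]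
          refine lt_of_le_of_lt (abs_sub _ _) ?_
          linarith
        have h5 : |Y j - Y' j| < 1 := by exact_mod_cast h4
        have := Int.abs_lt_one_iff.1 h5
        omega
      rw [hX, hY]
    have h0 := hind (fun i => (l i : ℤ) - l' i) (by
      simp only [sub_smul, Finset.sum_sub_distrib, heq, sub_self])
    funext i
    have := congrFun h0 i
    simp only [Pi.zero_apply] at this
    omega
  · set M := {v | v ∈ Γ ∧ ‖v‖ ≤ R}.ncard with hM
    set c : ℕ → Fin (d + 1) → ℝ := fun x => Fin.cons ((x : ℝ) / N) (fun j => Int.fract (θ j * x))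
      with hc
    have hc0 : ∀ x < N, ∀ i, 0 ≤ c x i ∧ c x i < 1 := by
      intro x hx i
      refine Fin.cases ?_ (fun j => ?_) i
      · simp only [hc, Fin.cons_zero]
        refine ⟨by positivity, ?_⟩
        rw [div_lt_one hNr]; exact_mod_cast hx
      · simp only [hc, Fin.cons_succ]
        exact ⟨Int.fract_nonneg _, Int.fract_lt_one _⟩
    set b : ℕ → Fin (d + 1) → ℕ := fun x i => ⌊q * c x i⌋₊ with hb
    have hfib : ∀ a ∈ (Finset.range N).image b,
        ((Finset.range N).filter (fun x => b x = a)).card ≤ M := by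
      intro a ha
      obtain ⟨x0, hx0, rfl⟩ := Finset.mem_image.1 ha
      rw [hM, Set.ncard_eq_toFinset_card _ (hfin R)]
      apply Finset.card_le_card_of_injOn (fun y : ℕ => latEmb N θ
        ((y : ℤ) - x0, fun j => ⌊θ j * y⌋ - ⌊θ j * x0⌋))
      · intro y hy
        simp only [Finset.coe_filter, Finset.mem_range, Set.mem_ofPred_eq] at hy
        simp only [Set.Finite.coe_toFinset, Set.mem_ofPred_eq]
        refine ⟨⟨_, rfl⟩, ?_⟩
        apply eucl_norm_le _ _ (by positivity)
        have hx0' : x0 < N := Finset.mem_range.1 hx0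
        intro i
        have e : latEmb N θ ((y : ℤ) - x0, fun j => ⌊θ j * y⌋ - ⌊θ j * x0⌋) i = c y i - c x0 i := by
          refine Fin.cases ?_ (fun j => ?_) i
          · rw [latEmb_zero]; simp only [hc, Fin.cons_zero]; push_cast; ring
          · rw [latEmb_succ]; simp only [hc, Fin.cons_succ, Int.fract]; push_cast; ring
        rw [e]
        have h1 : b y i = b x0 i := congrFun hy.2 i
        simp only [hb] at h1
        have h2 := Nat.floor_le (mul_nonneg hqr.le (hc0 y hy.1 i).1)
        have h3 := Nat.lt_floor_add_one (q * c y i)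
        have h4 := Nat.floor_le (mul_nonneg hqr.le (hc0 x0 hx0' i).1)
        have h5 := Nat.lt_floor_add_one (q * c x0 i)
        rw [h1] at h2 h3
        rw [le_div_iff₀ hqr, ← abs_of_pos hqr, ← abs_mul, abs_le]
        constructor <;> nlinarith
      · intro y _ y' _ hyy
        have := congrArg (fun w : EuclideanSpace ℝ (Fin (d + 1)) => w 0) hyy
        simp only [latEmb_zero] at this
        rw [div_left_inj' hNr.ne'] at this
        have h2 : (y : ℤ) - x0 = y' - x0 := by exact_mod_cast this
        omega
    have himg : ((Finset.range N).image b).card ≤ q ^ (d + 1) := by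
      calc _ ≤ (Fintype.piFinset (fun _ : Fin (d + 1) => Finset.range q)).card := by
            apply Finset.card_le_card
            intro f hf
            obtain ⟨x, hx, rfl⟩ := Finset.mem_image.1 hf
            simp only [Fintype.mem_piFinset, Finset.mem_range]
            intro i
            have := hc0 x (Finset.mem_range.1 hx) i
            rw [hb, Nat.floor_lt (mul_nonneg hqr.le this.1)]
            nlinarith [this.2]
        _ = q ^ (d + 1) := by simp
    calc N = (Finset.range N).card := by simp
      _ ≤ M * ((Finset.range N).image b).card := Finset.card_le_mul_card_image _ _ hfib
      _ ≤ (8 ^ (d + 1) * ∏ i, L i) * q ^ (d + 1) := by gcongr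
      _ = _ := by rw [mul_pow]; ring

lemma exp_le_cosh_sinh (t y : ℝ) (hy : |y| ≤ 1) :
    Real.exp (t * y) ≤ Real.cosh t + y * Real.sinh t := by
  obtain ⟨h1, h2⟩ := abs_le.1 hy
  have h3 : (0 : ℝ) ≤ (1 + y) / 2 := by linarith
  have h4 : (0 : ℝ) ≤ (1 - y) / 2 := by linarith
  have := convexOn_exp.2 (Set.mem_univ t) (Set.mem_univ (-t)) h3 h4 (by ring)
  simp only [smul_eq_mul] at this
  rw [show (1 + y) / 2 * t + (1 - y) / 2 * -t = t * y by ring] at this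
  refine this.trans (le_of_eq ?_)
  rw [Real.cosh_eq, Real.sinh_eq]; ring

/-- Hoeffding, counting form -/
lemma hoeffding_count {α : Type*} [DecidableEq α] (A : Finset α) (h : α → ℝ)
    (hb : ∀ a ∈ A, |h a| ≤ 1) (hsum : ∑ a ∈ A, h a = 0) (n : ℕ) (ε : ℝ) (hε : 0 ≤ ε) :
    (((Fintype.piFinset (fun _ : Fin n => A)).filter
      (fun a => ε * n ≤ ∑ i, h (a i))).card : ℝ) ≤ Real.exp (-(ε ^ 2 * n / 2)) * (A.card : ℝ) ^ n := by
  have h1 : ∑ a ∈ A, Real.exp (ε * h a) ≤ A.card * Real.exp (ε ^ 2 / 2) := by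
    calc ∑ a ∈ A, Real.exp (ε * h a) ≤ ∑ a ∈ A, (Real.cosh ε + h a * Real.sinh ε) :=
          Finset.sum_le_sum fun a ha => exp_le_cosh_sinh _ _ (hb a ha)
      _ = A.card * Real.cosh ε := by
          rw [Finset.sum_add_distrib, ← Finset.sum_mul, hsum]; simp
      _ ≤ _ := by gcongr; exact Real.cosh_le_exp_half_sq ε
  have h2 : ∑ a ∈ Fintype.piFinset (fun _ : Fin n => A), Real.exp (ε * ∑ i, h (a i)) =
      (∑ a ∈ A, Real.exp (ε * h a)) ^ n := by
    have := Finset.prod_univ_sum (fun _ : Fin n => A) (fun _ a => Real.exp (ε * h a))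
    simp only [Finset.prod_const, Finset.card_univ, Fintype.card_fin] at this
    rw [this]
    refine Finset.sum_congr rfl fun a _ => ?_
    rw [← Real.exp_sum, Finset.mul_sum]
  set S := (Fintype.piFinset (fun _ : Fin n => A)).filter (fun a => ε * n ≤ ∑ i, h (a i)) with hS
  have h3 : (S.card : ℝ) * Real.exp (ε ^ 2 * n) ≤ (A.card * Real.exp (ε ^ 2 / 2)) ^ n := by
    calc (S.card : ℝ) * Real.exp (ε ^ 2 * n) = ∑ a ∈ S, Real.exp (ε ^ 2 * n) := by simp
      _ ≤ ∑ a ∈ S, Real.exp (ε * ∑ i, h (a i)) := by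
          apply Finset.sum_le_sum
          intro a ha
          have := (Finset.mem_filter.1 ha).2
          apply Real.exp_le_exp.2
          nlinarith
      _ ≤ ∑ a ∈ Fintype.piFinset (fun _ : Fin n => A), Real.exp (ε * ∑ i, h (a i)) :=
          Finset.sum_le_sum_of_subset_of_nonneg (Finset.filter_subset _ _)
            fun _ _ _ => (Real.exp_pos _).le
      _ = (∑ a ∈ A, Real.exp (ε * h a)) ^ n := h2
      _ ≤ _ := by
          gcongr
  rw [mul_pow, ← Real.exp_nat_mul] at h3
  have h4 : (S.card : ℝ) = (S.card * Real.exp (ε ^ 2 * n)) * Real.exp (-(ε ^ 2 * n)) := by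
    rw [mul_assoc, ← Real.exp_add]; simp
  rw [h4]
  calc _ ≤ ((A.card : ℝ) ^ n * Real.exp (n * (ε ^ 2 / 2))) * Real.exp (-(ε ^ 2 * n)) := by gcongr
    _ = _ := by
      rw [mul_assoc, ← Real.exp_add, mul_comm]
      congr 2
      ring

/-- Chang's bound on dissociated subsets of the large spectrum. -/
lemma chang_bound {G : Type} [AddCommGroup G] [Fintype G] [DecidableEq G] (X : Finset G)
    (hX : X.Nonempty) (Λ : Finset (AddChar G ℂ)) (hΛ : AddDissociated (Λ : Set (AddChar G ℂ)))
    (hspec : ∀ γ ∈ Λ, (X.card : ℝ) / 2 ≤ ‖∑ x ∈ X, γ x‖) :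
    (Λ.card : ℝ) ≤ 8 * Real.log (Fintype.card G / X.card) := by
  classical
  have hXc : (0 : ℝ) < X.card := by exact_mod_cast hX.card_pos
  have hGc : (0 : ℝ) < Fintype.card G := by exact_mod_cast Fintype.card_pos_iff.2 ⟨0⟩
  -- phases
  have hph : ∀ γ : AddChar G ℂ, ∃ c : ℂ, ‖c‖ = 1 ∧ c * ∑ x ∈ X, γ x = ‖∑ x ∈ X, γ x‖ := by
    intro γ
    obtain ⟨c, hc, h⟩ := RCLike.exists_norm_eq_mul_self (K := ℂ) (∑ x ∈ X, γ x)
    exact ⟨c, hc, h.symm⟩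
  choose c hc1 hc2 using hph
  set t : ℝ := 1 / 2 with ht
  set Φ : G → ℝ := fun x => ∑ γ ∈ Λ, (c γ * γ x).re with hΦ
  -- upper bound on exponential moment
  have hup : ∑ x : G, Real.exp (t * Φ x) ≤ Fintype.card G * Real.exp (t ^ 2 / 2 * Λ.card) := by
    set dd : AddChar G ℂ → ℂ := fun γ => if γ ∈ Λ then (Real.sinh t : ℂ) * c γ else 0 with hdd
    set cc : AddChar G ℂ → ℝ := fun γ => if γ ∈ Λ then Real.cosh t else 1 with hcc
    have hr := AddDissociated.randomisation cc dd (hΛ.subset (by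
      intro ψ hψ
      by_contra h
      exact hψ (if_neg (by simpa using h))))
    have hprod : ∀ x : G, Real.exp (t * Φ x) ≤ ∏ γ, (cc γ + (dd γ * γ x).re) := by
      intro x
      rw [hΦ, Finset.mul_sum, Real.exp_sum]
      have : ∏ γ, (cc γ + (dd γ * γ x).re) = ∏ γ ∈ Λ, (cc γ + (dd γ * γ x).re) := by
        symm
        apply Finset.prod_subset (Finset.subset_univ _)
        intro γ _ hγ
        simp [hcc, hdd, hγ]
      rw [this]
      apply Finset.prod_le_prod
      · intro _ _; positivity
      · intro γ hγ
        simp only [hcc, hdd, hγ, if_true]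
        have h1 : |(c γ * γ x).re| ≤ 1 := by
          refine (Complex.abs_re_le_norm _).trans ?_
          rw [norm_mul, hc1, AddChar.norm_apply]; simp
        refine (exp_le_cosh_sinh t _ h1).trans (le_of_eq ?_)
        rw [mul_assoc, Complex.re_ofReal_mul, mul_comm]
    have hr2 : ∑ x : G, ∏ γ, (cc γ + (dd γ * γ x).re) = Fintype.card G * ∏ γ, cc γ := by
      rw [← hr, Fintype.card_mul_expect]
    calc _ ≤ _ := Finset.sum_le_sum fun x _ => hprod x
      _ = _ := hr2
      _ = Fintype.card G * Real.cosh t ^ Λ.card := by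
          simp [hcc, Finset.prod_ite]
      _ ≤ Fintype.card G * (Real.exp (t ^ 2 / 2)) ^ Λ.card := by
          gcongr
          exact Real.cosh_le_exp_half_sq t
      _ = _ := by rw [← Real.exp_nat_mul, mul_comm (Λ.card : ℝ)]
  -- lower bound
  have hlow : (X.card : ℝ) * (Λ.card / 2) ≤ ∑ x ∈ X, Φ x := by
    simp only [hΦ]
    rw [Finset.sum_comm]
    calc (X.card : ℝ) * (Λ.card / 2) = ∑ γ ∈ Λ, (X.card : ℝ) / 2 := by simp; ring
      _ ≤ ∑ γ ∈ Λ, ∑ x ∈ X, (c γ * γ x).re := by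
        apply Finset.sum_le_sum
        intro γ hγ
        rw [← Complex.re_sum, ← Finset.mul_sum, hc2]
        simpa using hspec γ hγ
  have hjen : (X.card : ℝ) * Real.exp (t * (Λ.card / 2)) ≤ ∑ x ∈ X, Real.exp (t * Φ x) := by
    have h := convexOn_exp.map_sum_le (t := X) (w := fun _ => (1 : ℝ) / X.card)
      (p := fun x => t * Φ x) (fun _ _ => by positivity) (by simp; field_simp)
      (fun _ _ => Set.mem_univ _)
    simp only [smul_eq_mul, ← Finset.mul_sum] at h
    rw [one_div, le_inv_mul_iff₀ hXc] at h
    refine le_trans ?_ h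
    apply mul_le_mul_of_nonneg_left _ hXc.le
    apply Real.exp_le_exp.2
    rw [le_inv_mul_iff₀ hXc]
    nlinarith
  have hsub : ∑ x ∈ X, Real.exp (t * Φ x) ≤ ∑ x : G, Real.exp (t * Φ x) :=
    Finset.sum_le_sum_of_subset_of_nonneg (Finset.subset_univ _) fun _ _ _ => (Real.exp_pos _).le
  have hfin : (X.card : ℝ) * Real.exp (t * (Λ.card / 2)) ≤
      Fintype.card G * Real.exp (t ^ 2 / 2 * Λ.card) := hjen.trans (hsub.trans hup)
  have h5 : Real.exp ((Λ.card : ℝ) / 8) ≤ Fintype.card G / X.card := by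
    rw [le_div_iff₀ hXc]
    have e1 : t * ((Λ.card : ℝ) / 2) = (Λ.card : ℝ) / 8 + t ^ 2 / 2 * Λ.card := by rw [ht]; ring
    rw [e1, Real.exp_add, ← mul_assoc] at hfin
    have := le_of_mul_le_mul_right hfin (Real.exp_pos _)
    linarith
  have := Real.log_le_log (Real.exp_pos _) h5
  rw [Real.log_exp] at this
  linarith

/-- averaging operator -/
noncomputable def avgF {G : Type} [AddCommGroup G] (A : Finset G) (g : G → ℝ) (x : G) : ℝ :=
  (∑ a ∈ A, g (x + a)) / A.card

lemma almost_periods {G : Type} [AddCommGroup G] [Fintype G] [DecidableEq G] (A : Finset G)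
    (hA : A.Nonempty) (g : G → ℝ) (hg0 : ∀ x, 0 ≤ g x) (hg1 : ∀ x, g x ≤ 1) (n : ℕ) (hn : 0 < n)
    (ε η : ℝ) (hε : 0 ≤ ε) (hη : 0 < η)
    (hpar : 4 * Real.exp (-(ε ^ 2 * n / 2)) * Fintype.card G ≤ η * A.card) :
    ∃ X : Finset G, X.Nonempty ∧
      (Fintype.card G : ℝ) * (A.card : ℝ) ^ n ≤ 2 * X.card * (Fintype.card G : ℝ) ^ n ∧
      ∀ t ∈ X, ((Finset.univ.filter (fun x => avgF A g (x + t) < avgF A g x - 2 * ε)).card : ℝ)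
        ≤ 2 * η * A.card := by
  classical
  have hAc : (0 : ℝ) < A.card := by exact_mod_cast hA.card_pos
  have hGc : (0 : ℝ) < Fintype.card G := by exact_mod_cast Fintype.card_pos_iff.2 ⟨0⟩
  have hnr : (0 : ℝ) < n := by exact_mod_cast hn
  set f := avgF A g with hf
  have hf0 : ∀ x, 0 ≤ f x := fun x => by
    apply div_nonneg (Finset.sum_nonneg fun a _ => hg0 _) hAc.le
  have hf1 : ∀ x, f x ≤ 1 := fun x => by
    rw [hf, avgF, div_le_one hAc]
    calc _ ≤ ∑ a ∈ A, (1 : ℝ) := Finset.sum_le_sum fun a _ => hg1 _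
      _ = _ := by simp
  set P := Fintype.piFinset (fun _ : Fin n => A) with hP
  have hPc : (P.card : ℝ) = (A.card : ℝ) ^ n := by simp [hP]
  set bad : (Fin n → G) → Finset G := fun a =>
    Finset.univ.filter (fun x => ε * n ≤ |∑ i, (g (x + a i) - f x)|) with hbad
  have hcount : ∀ x, ((P.filter (fun a => x ∈ bad a)).card : ℝ) ≤
      2 * Real.exp (-(ε ^ 2 * n / 2)) * (A.card : ℝ) ^ n := by
    intro x
    have hs : ∑ a ∈ A, (g (x + a) - f x) = 0 := by
      rw [Finset.sum_sub_distrib, Finset.sum_const, nsmul_eq_mul, hf, avgF]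
      field_simp; ring
    have hb : ∀ a ∈ A, |g (x + a) - f x| ≤ 1 := by
      intro a _
      rw [abs_le]
      constructor <;> linarith [hg0 (x + a), hg1 (x + a), hf0 x, hf1 x]
    have h1 := hoeffding_count A (fun a => g (x + a) - f x) hb hs n ε hε
    have h2 := hoeffding_count A (fun a => -(g (x + a) - f x)) (by simpa [abs_sub_comm] using hb)
      (by rw [Finset.sum_neg_distrib, hs, neg_zero]) n ε hε
    have h3 : P.filter (fun a => x ∈ bad a) ⊆
        P.filter (fun a => ε * n ≤ ∑ i, (g (x + a i) - f x)) ∪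
        P.filter (fun a => ε * n ≤ ∑ i, -(g (x + a i) - f x)) := by
      intro a ha
      simp only [hbad, Finset.mem_filter, Finset.mem_univ, true_and, Finset.mem_union] at ha ⊢
      rcases le_abs.1 ha.2 with h | h
      · exact Or.inl ⟨ha.1, h⟩
      · right; rw [Finset.sum_neg_distrib]; exact ⟨ha.1, h⟩
    have h4 := (Finset.card_le_card h3).trans (Finset.card_union_le _ _)
    have h5 : ((P.filter (fun a => x ∈ bad a)).card : ℝ) ≤
      (P.filter (fun a => ε * n ≤ ∑ i, (g (x + a i) - f x))).card +
        (P.filter (fun a => ε * n ≤ ∑ i, -(g (x + a i) - f x))).card := by exact_mod_cast h4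
    linarith
  set T := P.filter (fun a => ((bad a).card : ℝ) ≤ η * A.card) with hT
  have hTc : (A.card : ℝ) ^ n ≤ 2 * T.card := by
    have h1 : ∑ a ∈ P, ((bad a).card : ℝ) ≤ Fintype.card G *
        (2 * Real.exp (-(ε ^ 2 * n / 2)) * (A.card : ℝ) ^ n) := by
      have : ∑ a ∈ P, ((bad a).card : ℝ) = ∑ x : G, ((P.filter (fun a => x ∈ bad a)).card : ℝ) := by
        have := Finset.sum_card_bipartiteAbove_eq_sum_card_bipartiteBelow
          (s := P) (t := (Finset.univ : Finset G)) (fun a x => x ∈ bad a)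
        simp only [Finset.bipartiteAbove, Finset.bipartiteBelow, Finset.filter_univ_mem] at this
        exact_mod_cast this
      rw [this]
      calc _ ≤ ∑ x : G, (2 * Real.exp (-(ε ^ 2 * n / 2)) * (A.card : ℝ) ^ n) :=
            Finset.sum_le_sum fun x _ => hcount x
        _ = _ := by simp
    have h2 : ((P.filter (fun a => ¬ ((bad a).card : ℝ) ≤ η * A.card)).card : ℝ) * (η * A.card) ≤
        ∑ a ∈ P, ((bad a).card : ℝ) := by
      calc _ = ∑ a ∈ P.filter (fun a => ¬ ((bad a).card : ℝ) ≤ η * A.card), (η * A.card) := by simp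
        _ ≤ ∑ a ∈ P.filter (fun a => ¬ ((bad a).card : ℝ) ≤ η * A.card), ((bad a).card : ℝ) := by
            apply Finset.sum_le_sum
            intro a ha
            have := (Finset.mem_filter.1 ha).2
            linarith
        _ ≤ _ := Finset.sum_le_sum_of_subset_of_nonneg (Finset.filter_subset _ _)
            fun _ _ _ => by positivity
    have h3 : (T.card : ℝ) + (P.filter (fun a => ¬ ((bad a).card : ℝ) ≤ η * A.card)).card =
        (A.card : ℝ) ^ n := by
      rw [← hPc]
      exact_mod_cast Finset.card_filter_add_card_filter_not (s := P)
        (fun a => ((bad a).card : ℝ) ≤ η * A.card)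
    set u := ((P.filter (fun a => ¬ ((bad a).card : ℝ) ≤ η * A.card)).card : ℝ)
    have h4 : u * (η * A.card) ≤ ((A.card : ℝ) ^ n / 2) * (η * A.card) := by
      have : (0 : ℝ) ≤ (A.card : ℝ) ^ n := by positivity
      nlinarith
    have h5 := le_of_mul_le_mul_right h4 (by positivity)
    linarith
  -- pigeonhole
  set X0 : (Fin n → G) → Finset G := fun z => Finset.univ.filter (fun b => (fun i => z i + b) ∈ T)
    with hX0
  have hsumX : ∑ z : Fin n → G, ((X0 z).card : ℝ) = Fintype.card G * T.card := by
    have := Finset.sum_card_bipartiteAbove_eq_sum_card_bipartiteBelow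
      (s := (Finset.univ : Finset (Fin n → G))) (t := (Finset.univ : Finset G))
      (fun z b => (fun i => z i + b) ∈ T)
    simp only [Finset.bipartiteAbove, Finset.bipartiteBelow] at this
    have h2 : ∀ b : G, (Finset.univ.filter (fun z : Fin n → G => (fun i => z i + b) ∈ T)).card
        = T.card := by
      intro b
      apply Finset.card_bij (fun z _ => fun i => z i + b)
      · intro z hz; simpa using hz
      · intro z _ z' _ h
        funext i
        have := congrFun h i
        simpa using this
      · intro w hw
        refine ⟨fun i => w i - b, ?_, ?_⟩ <;> simp [hw]
    simp only [h2, Finset.sum_const, Finset.card_univ, smul_eq_mul] at this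
    simp only [hX0]
    exact_mod_cast this
  obtain ⟨z, -, hz⟩ : ∃ z ∈ (Finset.univ : Finset (Fin n → G)),
      (Fintype.card G * T.card : ℝ) / (Fintype.card G : ℝ) ^ n ≤ (X0 z).card := by
    apply Finset.exists_le_of_sum_le ⟨fun _ => 0, Finset.mem_univ _⟩
    rw [hsumX]
    simp
    field_simp
    exact le_rfl
  rw [div_le_iff₀ (by positivity)] at hz
  have hTpos : (0 : ℝ) < T.card := by
    have : (0 : ℝ) < (A.card : ℝ) ^ n := by positivity
    linarith
  have hX0ne : (X0 z).Nonempty := by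
    rw [Finset.nonempty_iff_ne_empty]
    intro h
    rw [h] at hz
    simp at hz
    nlinarith [mul_pos hGc hTpos]
  obtain ⟨b0, hb0⟩ := hX0ne
  refine ⟨(X0 z).image (fun b => b - b0), ⟨b0 - b0, Finset.mem_image_of_mem _ hb0⟩, ?_, ?_⟩
  · rw [Finset.card_image_of_injective _ sub_left_injective]
    nlinarith
  · intro t ht
    obtain ⟨b, hb, rfl⟩ := Finset.mem_image.1 ht
    simp only [hX0, Finset.mem_filter, Finset.mem_univ, true_and] at hb hb0
    have hbT := (Finset.mem_filter.1 hb).2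
    have hb0T := (Finset.mem_filter.1 hb0).2
    have hsub : Finset.univ.filter (fun x => f (x + (b - b0)) < f x - 2 * ε) ⊆
        bad (fun i => z i + b) ∪ (bad (fun i => z i + b0)).image (fun x => x - (b - b0)) := by
      intro x hx
      simp only [Finset.mem_filter, Finset.mem_univ, true_and] at hx
      by_contra hcon
      simp only [Finset.mem_union, not_or] at hcon
      obtain ⟨h1, h2⟩ := hcon
      have h2' : x + (b - b0) ∉ bad (fun i => z i + b0) := fun h =>
        h2 (Finset.mem_image.2 ⟨_, h, by abel⟩)
      simp only [hbad, Finset.mem_filter, Finset.mem_univ, true_and, not_le] at h1 h2'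
      have e : ∀ i, x + (b - b0) + (z i + b0) = x + (z i + b) := fun i => by abel
      simp only [e, Finset.sum_sub_distrib, Finset.sum_const, Finset.card_univ, Fintype.card_fin,
        nsmul_eq_mul] at h1 h2'
      have h3 := abs_lt.1 h1
      have h4 := abs_lt.1 h2'
      nlinarith
    have hc := (Finset.card_le_card hsub).trans
      ((Finset.card_union_le _ _).trans (Nat.add_le_add_left Finset.card_image_le _))
    have hc' : ((Finset.univ.filter (fun x => f (x + (b - b0)) < f x - 2 * ε)).card : ℝ) ≤
      (bad (fun i => z i + b)).card + (bad (fun i => z i + b0)).card := by exact_mod_cast hc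
    linarith

lemma spec_span {G : Type} [AddCommGroup G] [Fintype G] [DecidableEq G] (X : Finset G)
    (hX : X.Nonempty) : ∃ Λ : Finset (AddChar G ℂ),
      (Λ.card : ℝ) ≤ 8 * Real.log (Fintype.card G / X.card) ∧
      ∀ γ : AddChar G ℂ, (X.card : ℝ) / 2 ≤ ‖∑ x ∈ X, γ x‖ → ∀ (y : G) (δ : ℝ),
        (∀ l ∈ Λ, ‖l y - 1‖ ≤ δ) → ‖γ y - 1‖ ≤ Λ.card * δ := by
  classical
  have hXc : (0 : ℝ) < X.card := by exact_mod_cast hX.card_pos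
  have hXG : (X.card : ℝ) ≤ Fintype.card G := by exact_mod_cast X.card_le_univ
  have hpos : 0 ≤ 8 * Real.log (Fintype.card G / X.card) := by
    have := Real.log_nonneg ((one_le_div hXc).2 hXG)
    linarith
  obtain ⟨Λ, h1, h2, h3⟩ := Finset.exists_subset_addSpan_card_le_of_forall_addDissociated
    (s := Finset.univ.filter (fun γ : AddChar G ℂ => (X.card : ℝ) / 2 ≤ ‖∑ x ∈ X, γ x‖))
    (d := ⌊8 * Real.log (Fintype.card G / X.card)⌋₊) (by
      intro s hs hd
      apply Nat.le_floor
      exact chang_bound X hX s hd (fun γ hγ => (Finset.mem_filter.1 (hs hγ)).2))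
  refine ⟨Λ, (Nat.le_floor_iff hpos).1 h2, ?_⟩
  intro γ hγ y δ hδ
  obtain ⟨e, he, rfl⟩ := Finset.mem_addSpan.1 (h3 (Finset.mem_filter.2 ⟨Finset.mem_univ _, hγ⟩))
  clear h1 h2 h3 hγ
  induction Λ using Finset.induction_on with
  | empty => simp
  | insert a s ha ih =>
    rw [Finset.sum_insert ha, Finset.card_insert_of_notMem ha]
    have ih' := ih (fun l hl => hδ l (Finset.mem_insert_of_mem hl))
    have h0 : ‖(e a • a) y - 1‖ ≤ δ := by
      have h1 := hδ a (Finset.mem_insert_self _ _)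
      rcases he a with h | h | h
      · rw [h, neg_one_zsmul]
        have h2 : ‖a y‖ = 1 := AddChar.norm_apply a y
        have h3 : a y ≠ 0 := fun h => by simp [h] at h2
        have : (-a) y - 1 = -((-a) y) * (a y - 1) := by
          rw [AddChar.neg_apply, AddChar.map_neg_eq_inv]; field_simp; ring
        rw [this, norm_mul, norm_neg, AddChar.norm_apply, one_mul]; exact h1
      · rw [h, zero_zsmul]; simp; exact (norm_nonneg _).trans h1
      · rw [h, one_zsmul]; exact h1
    have : (e a • a + ∑ x ∈ s, e x • x) y - 1 =
      (e a • a) y * ((∑ x ∈ s, e x • x : AddChar G ℂ) y - 1) + ((e a • a) y - 1) := by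
      rw [AddChar.add_apply]; ring
    rw [this]
    refine (norm_add_le _ _).trans ?_
    rw [norm_mul, AddChar.norm_apply, one_mul]
    rw [Nat.cast_add, Nat.cast_one]
    linarith

lemma fourier_diff {G : Type} [AddCommGroup G] [Fintype G] [DecidableEq G] (A B X : Finset G)
    (k : ℕ) (y : G) (τ : ℝ) (hτ : ∀ γ : AddChar G ℂ, ‖∑ x ∈ X, γ x‖ ^ k * ‖γ y - 1‖ ≤ τ)
    (S : G → ℝ) (hS : ∀ z, S z = ∑ x ∈ Fintype.piFinset (fun _ : Fin k => X), ∑ a ∈ A, ∑ a' ∈ A,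
      (if a + a' + z + ∑ i, x i ∈ B then (1 : ℝ) else 0)) :
    |S y - S 0| ≤ B.card * A.card * τ := by
  classical
  have hGc : (0 : ℝ) < Fintype.card G := by exact_mod_cast Fintype.card_pos_iff.2 ⟨0⟩
  have key : ∀ z : G, (Fintype.card G : ℂ) * (if z ∈ B then 1 else 0) =
      ∑ γ : AddChar G ℂ, (∑ b ∈ B, γ (-b)) * γ z := by
    intro z
    simp_rw [Finset.sum_mul, ← AddChar.map_add_eq_mul]
    rw [Finset.sum_comm]
    simp_rw [AddChar.sum_apply_eq_ite, neg_add_eq_zero]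
    simp
  have hF : ∀ z, (Fintype.card G : ℂ) * (S z : ℂ) = ∑ γ : AddChar G ℂ,
      (∑ b ∈ B, γ (-b)) * ((∑ a ∈ A, γ a) ^ 2 * (∑ x ∈ X, γ x) ^ k * γ z) := by
    intro z
    rw [hS]
    push_cast
    have : ∀ γ : AddChar G ℂ, (∑ a ∈ A, γ a) ^ 2 * (∑ x ∈ X, γ x) ^ k * γ z =
        ∑ x ∈ Fintype.piFinset (fun _ : Fin k => X), ∑ a ∈ A, ∑ a' ∈ A, γ (a + a' + z + ∑ i, x i) := by
      intro γ
      have h1 : (∑ x ∈ X, γ x) ^ k = ∑ x ∈ Fintype.piFinset (fun _ : Fin k => X), γ (∑ i, x i) := by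
        have := Finset.prod_univ_sum (fun _ : Fin k => X) (fun _ x => γ x)
        simp only [Finset.prod_const, Finset.card_univ, Fintype.card_fin] at this
        rw [this]
        refine Finset.sum_congr rfl fun x _ => ?_
        have h := map_prod γ.toMonoidHom (fun i => Multiplicative.ofAdd (x i)) Finset.univ
        rw [← ofAdd_sum] at h
        exact h.symm
      rw [h1, Finset.mul_sum, Finset.sum_mul]
      refine Finset.sum_congr rfl fun x _ => ?_
      rw [pow_two, Finset.sum_mul_sum, Finset.sum_mul, Finset.sum_mul]
      refine Finset.sum_congr rfl fun a _ => ?_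
      rw [Finset.sum_mul, Finset.sum_mul]
      refine Finset.sum_congr rfl fun a' _ => ?_
      simp only [AddChar.map_add_eq_mul]; ring
    simp_rw [this]
    simp_rw [Finset.mul_sum]
    conv_rhs => rw [Finset.sum_comm]
    refine Finset.sum_congr rfl fun x _ => ?_
    conv_rhs => rw [Finset.sum_comm]
    refine Finset.sum_congr rfl fun a _ => ?_
    conv_rhs => rw [Finset.sum_comm]
    refine Finset.sum_congr rfl fun a' _ => ?_
    rw [← key]; split_ifs <;> simp
  have hpars : ∑ γ : AddChar G ℂ, ‖∑ a ∈ A, γ a‖ ^ 2 = A.card * Fintype.card G := by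
    have : (∑ γ : AddChar G ℂ, ‖∑ a ∈ A, γ a‖ ^ 2 : ℂ) = A.card * Fintype.card G := by
      have h : ∀ γ : AddChar G ℂ, ((‖∑ a ∈ A, γ a‖ : ℂ) ^ 2) = ∑ a ∈ A, ∑ b ∈ A, γ (a - b) := by
        intro γ
        rw [← Complex.mul_conj', map_sum, Finset.sum_mul_sum]
        refine Finset.sum_congr rfl fun a _ => Finset.sum_congr rfl fun b _ => ?_
        rw [← AddChar.map_neg_eq_conj, sub_eq_add_neg, AddChar.map_add_eq_mul]
      simp_rw [h]
      rw [Finset.sum_comm]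
      conv_lhs => enter [2, a]; rw [Finset.sum_comm]
      simp_rw [AddChar.sum_apply_eq_ite, sub_eq_zero]
      simp
    exact_mod_cast this
  have hfin : (Fintype.card G : ℝ) * |S y - S 0| ≤ Fintype.card G * (B.card * A.card * τ) := by
    have h1 : (Fintype.card G : ℂ) * ((S y - S 0 : ℝ) : ℂ) = ∑ γ : AddChar G ℂ,
      (∑ b ∈ B, γ (-b)) * ((∑ a ∈ A, γ a) ^ 2 * ((∑ x ∈ X, γ x) ^ k * (γ y - 1))) := by
      push_cast
      rw [mul_sub, hF, hF, ← Finset.sum_sub_distrib]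
      refine Finset.sum_congr rfl fun γ _ => ?_
      rw [AddChar.map_zero_eq_one]; ring
    have h2 : (Fintype.card G : ℝ) * |S y - S 0| =
        ‖(Fintype.card G : ℂ) * ((S y - S 0 : ℝ) : ℂ)‖ := by
      rw [norm_mul, Complex.norm_real, Real.norm_eq_abs, Complex.norm_natCast]
    rw [h2, h1]
    calc _ ≤ ∑ γ : AddChar G ℂ, B.card * (‖∑ a ∈ A, γ a‖ ^ 2 * τ) := by
          refine (norm_sum_le _ _).trans (Finset.sum_le_sum fun γ _ => ?_)
          rw [norm_mul, norm_mul, norm_pow, norm_mul, norm_pow]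
          have h3 : ‖∑ b ∈ B, γ (-b)‖ ≤ B.card := by
            refine (norm_sum_le _ _).trans ?_
            simp [AddChar.norm_apply]
          have := hτ γ
          gcongr
      _ = _ := by
        rw [← Finset.mul_sum, ← Finset.sum_mul, hpars]; ring
  exact le_of_mul_le_mul_left hfin hGc

lemma period_sum {G : Type} [AddCommGroup G] [Fintype G] [DecidableEq G] (f : G → ℝ)
    (X : Finset G) (e h : ℝ)
    (hX : ∀ t ∈ X, ((Finset.univ.filter (fun y => f (y + t) < f y - e)).card : ℝ) ≤ h) (j : ℕ) :
    ∀ x : Fin j → G, (∀ i, x i ∈ X) →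
      ((Finset.univ.filter (fun y => f (y + ∑ i, x i) < f y - j * e)).card : ℝ) ≤ j * h := by
  induction j with
  | zero => intro x _; simp
  | succ j ih =>
    intro x hx
    have ih' := ih (fun i => x i.succ) (fun i => hx _)
    have h0 := hX _ (hx 0)
    rw [Fin.sum_univ_succ]
    set t := ∑ i : Fin j, x i.succ
    have hsub : Finset.univ.filter (fun y => f (y + (x 0 + t)) < f y - ((j + 1 : ℕ) : ℝ) * e) ⊆
        Finset.univ.filter (fun y => f (y + x 0) < f y - e) ∪
        (Finset.univ.filter (fun y => f (y + t) < f y - j * e)).image (fun y => y - x 0) := by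
      intro y hy
      simp only [Finset.mem_filter, Finset.mem_univ, true_and, Finset.mem_union,
        Finset.mem_image] at hy ⊢
      by_cases h1 : f (y + x 0) < f y - e
      · exact Or.inl h1
      · right
        refine ⟨y + x 0, ?_, by simp⟩
        rw [add_assoc]
        push_cast at hy
        push Not at h1
        linarith
    have h2 := (Finset.card_le_card hsub).trans (Finset.card_union_le _ _)
    have h3 := h2.trans (Nat.add_le_add_left (Finset.card_image_le) _)
    have h4 : ((Finset.univ.filter
        (fun y => f (y + (x 0 + t)) < f y - ((j + 1 : ℕ) : ℝ) * e)).card : ℝ) ≤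
      (Finset.univ.filter (fun y => f (y + x 0) < f y - e)).card +
      (Finset.univ.filter (fun y => f (y + t) < f y - j * e)).card := by exact_mod_cast h3
    push_cast at h4 ⊢
    linarith

lemma exp_param (m : ℕ) : 4 * Real.exp (-(4 * (m + 4 : ℕ) : ℝ)) * 2 ^ m ≤ 1 / (8 * (m + 4 : ℕ)) := by
  rw [Real.exp_neg, le_div_iff₀ (by positivity), mul_comm 4 (Real.exp _)⁻¹, mul_assoc, mul_assoc,
    inv_mul_le_iff₀ (Real.exp_pos _), mul_one]
  have h1 : (16 : ℝ) ≤ Real.exp 4 := by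
    have := Real.add_one_le_exp (1 : ℝ)
    have h2 : Real.exp 4 = Real.exp 1 ^ 4 := by rw [← Real.exp_nat_mul]; norm_num
    rw [h2]
    calc (16 : ℝ) = 2 ^ 4 := by norm_num
      _ ≤ _ := by gcongr; linarith
  have h3 : ((m + 4 : ℕ) : ℝ) ≤ 2 ^ (m + 4) := by
    exact_mod_cast (Nat.lt_two_pow_self).le
  have h4 : Real.exp (4 * (m + 4 : ℕ)) = Real.exp 4 ^ (m + 4) := by
    rw [← Real.exp_nat_mul]; ring_nf
  rw [h4]
  calc 4 * (2 ^ m * (8 * ((m + 4 : ℕ) : ℝ))) ≤ 4 * (2 ^ m * (8 * 2 ^ (m + 4))) := by gcongr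
    _ = 512 * (2 ^ m * 2 ^ m) := by ring
    _ ≤ 65536 * (4 ^ m * 4 ^ m) := by gcongr <;> norm_num
    _ = 16 ^ (m + 4) := by rw [pow_add, ← mul_pow]; norm_num; ring
    _ ≤ _ := by gcongr

lemma bogo {G : Type} [AddCommGroup G] [Fintype G] [DecidableEq G] (A : Finset G)
    (hA : A.Nonempty) (m : ℕ) (hcard : (Fintype.card G : ℝ) ≤ 2 ^ m * A.card) :
    ∃ Λ : Finset (AddChar G ℂ), Λ.card ≤ 8 * (512 * m * (m + 4) ^ 3 + 1) ∧
      ∀ y : G, (∀ l ∈ Λ, ‖l y - 1‖ ≤ 1 / (8 * 2 ^ m * (Λ.card + 1))) → y ∈ 4 • A - 4 • A := by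
  classical
  have hAc : (0 : ℝ) < A.card := by exact_mod_cast hA.card_pos
  have hGc : (0 : ℝ) < Fintype.card G := by exact_mod_cast Fintype.card_pos_iff.2 ⟨0⟩
  set k := m + 4 with hk
  have hk0 : (0 : ℝ) < k := by positivity
  set n := 512 * k ^ 3 with hn
  set g : G → ℝ := fun x => if x ∈ A + A then 1 else 0 with hg
  have hg0 : ∀ x, 0 ≤ g x := fun x => by simp only [hg]; split_ifs <;> norm_num
  have hg1 : ∀ x, g x ≤ 1 := fun x => by simp only [hg]; split_ifs <;> norm_num
  obtain ⟨X, hXn, hXc, hX⟩ := almost_periods A hA g hg0 hg1 n (by positivity) (1 / (8 * k))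
    (1 / (8 * k)) (by positivity) (by positivity) (by
      have h1 := exp_param m
      have h2 : ((1 / (8 * (k : ℝ))) ^ 2 * (n : ℕ) / 2 : ℝ) = 4 * k := by
        rw [hn]; push_cast; field_simp; norm_num
      rw [h2]
      calc _ ≤ 4 * Real.exp (-(4 * (k : ℝ))) * (2 ^ m * A.card) := by gcongr
        _ = (4 * Real.exp (-(4 * (k : ℝ))) * 2 ^ m) * A.card := by ring
        _ ≤ _ := by gcongr)
  clear_value n k
  have hX0 : (0 : ℝ) < X.card := by exact_mod_cast hXn.card_pos
  obtain ⟨Λ, hΛc, hΛ⟩ := spec_span X hXn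
  refine ⟨Λ, ?_, ?_⟩
  · have h1 : (Fintype.card G : ℝ) / X.card ≤ 2 ^ (m * n + 1) := by
      rw [div_le_iff₀ hX0]
      have h2 : (Fintype.card G : ℝ) * (A.card : ℝ) ^ n ≤
          (2 ^ (m * n + 1) * X.card) * (A.card : ℝ) ^ n := by
        calc _ ≤ 2 * X.card * (Fintype.card G : ℝ) ^ n := hXc
          _ ≤ 2 * X.card * (2 ^ m * A.card) ^ n := by gcongr
          _ = _ := by rw [mul_pow, ← pow_mul]; ring
      exact le_of_mul_le_mul_right h2 (by positivity)
    have h2 : Real.log (Fintype.card G / X.card) ≤ m * n + 1 := by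
      calc _ ≤ Real.log (2 ^ (m * n + 1)) := Real.log_le_log (by positivity) h1
        _ = (m * n + 1 : ℕ) * Real.log 2 := by rw [Real.log_pow]
        _ ≤ (m * n + 1 : ℕ) * 1 := by gcongr; linarith [Real.log_two_lt_d9]
        _ = _ := by push_cast; ring
    have h3 : (Λ.card : ℝ) ≤ (8 * (512 * m * k ^ 3 + 1) : ℕ) := by
      refine hΛc.trans ?_
      push_cast
      have : ((n : ℕ) : ℝ) = 512 * (k : ℝ) ^ 3 := by rw [hn]; push_cast; ring
      rw [this] at h2
      linarith
    exact_mod_cast h3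
  · intro y hy
    set S : G → ℝ := fun z => ∑ x ∈ Fintype.piFinset (fun _ : Fin k => X), ∑ a ∈ A, ∑ a' ∈ A,
      (if a + a' + z + ∑ i, x i ∈ A + A then (1 : ℝ) else 0) with hS
    have hf1 : ∀ a ∈ A, avgF A g a = 1 := by
      intro a ha
      rw [avgF, div_eq_one_iff_eq hAc.ne', Finset.sum_congr rfl (g := fun _ => (1 : ℝ))]
      · simp
      · intro b hb; simp only [hg]; rw [if_pos (Finset.add_mem_add ha hb)]
    have hf0 : ∀ x, 0 ≤ avgF A g x := fun x => by
      apply div_nonneg (Finset.sum_nonneg fun a _ => hg0 _) hAc.le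
    -- each sum of almost periods
    have hT : ∀ x ∈ Fintype.piFinset (fun _ : Fin k => X),
        (A.card : ℝ) ^ 2 / 2 ≤ ∑ a ∈ A, ∑ a' ∈ A,
          (if a + a' + ∑ i, x i ∈ A + A then (1 : ℝ) else 0) := by
      intro x hx
      have h1 := period_sum (avgF A g) X _ _ hX k x (fun i => Fintype.mem_piFinset.1 hx i)
      set t := ∑ i, x i
      have h2 : (k : ℝ) * (2 * (1 / (8 * k))) = 1 / 4 := by field_simp; norm_num
      have h3 : (k : ℝ) * (2 * (1 / (8 * k)) * A.card) = 1 / 4 * A.card := by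
        rw [← mul_assoc, h2]
      rw [h2, h3] at h1
      have h4 : ∀ a, ∑ a' ∈ A, (if a + a' + t ∈ A + A then (1 : ℝ) else 0) =
          A.card * avgF A g (a + t) := by
        intro a
        rw [avgF, mul_div_cancel₀ _ hAc.ne']
        refine Finset.sum_congr rfl fun b _ => ?_
        simp only [hg, add_right_comm]
      simp_rw [h4]
      rw [← Finset.mul_sum]
      have h5 : ∀ a ∈ A, 3 / 4 - (if avgF A g (a + t) < avgF A g a - 1 / 4 then (1 : ℝ) else 0) ≤
          avgF A g (a + t) := by
        intro a ha
        have := hf0 (a + t)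
        rw [hf1 a ha]
        split_ifs with h
        · linarith
        · push Not at h; linarith
      have h6 := Finset.sum_le_sum h5
      rw [Finset.sum_sub_distrib, Finset.sum_const, nsmul_eq_mul, Finset.sum_boole] at h6
      have h7 : ((A.filter (fun a => avgF A g (a + t) < avgF A g a - 1 / 4)).card : ℝ) ≤
          ((Finset.univ.filter (fun a => avgF A g (a + t) < avgF A g a - 1 / 4)).card : ℝ) := by
        exact_mod_cast Finset.card_le_card (Finset.filter_subset_filter _ (Finset.subset_univ _))
      have h8 : (A.card : ℝ) / 2 ≤ ∑ a ∈ A, avgF A g (a + t) := by linarith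
      nlinarith
    have hS0 : (A.card : ℝ) ^ 2 / 2 * (X.card : ℝ) ^ k ≤ S 0 := by
      have := Finset.sum_le_sum hT
      simp only [hS, add_zero]
      refine le_trans (le_of_eq ?_) this
      rw [Finset.sum_const, nsmul_eq_mul, Fintype.card_piFinset]
      simp; ring
    have hdiff := fourier_diff A (A + A) X k y ((X.card : ℝ) ^ k * (1 / (4 * 2 ^ m))) (by
      intro γ
      have hle : ‖∑ x ∈ X, γ x‖ ≤ X.card := by
        refine (norm_sum_le _ _).trans ?_
        simp [AddChar.norm_apply]
      by_cases hγ : (X.card : ℝ) / 2 ≤ ‖∑ x ∈ X, γ x‖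
      · have h1 := hΛ γ hγ y _ hy
        have h2 : (Λ.card : ℝ) * (1 / (8 * 2 ^ m * (Λ.card + 1))) ≤ 1 / (4 * 2 ^ m) := by
          rw [mul_one_div, div_le_div_iff₀ (by positivity) (by positivity)]
          have : (0 : ℝ) ≤ Λ.card * 2 ^ m := by positivity
          have h3 : (0 : ℝ) ≤ 2 ^ m := by positivity
          nlinarith
        gcongr
        exact h1.trans h2
      · push Not at hγ
        have h1 : ‖γ y - 1‖ ≤ 2 := by
          refine (norm_sub_le _ _).trans ?_
          rw [AddChar.norm_apply]; norm_num
        calc _ ≤ ((X.card : ℝ) / 2) ^ k * 2 := by gcongr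
          _ = (X.card : ℝ) ^ k * (2 / 2 ^ k) := by rw [div_pow]; ring
          _ ≤ _ := by
            refine mul_le_mul_of_nonneg_left ?_ (by positivity)
            rw [hk, pow_add, div_le_div_iff₀ (by positivity) (by positivity)]
            have h3 : (0 : ℝ) ≤ 2 ^ m := by positivity
            linarith) S (fun z => rfl)
    have hAA : ((A + A).card : ℝ) ≤ 2 ^ m * A.card := by
      refine le_trans ?_ hcard
      exact_mod_cast Finset.card_le_univ _
    have hb : ((A + A).card : ℝ) * A.card * ((X.card : ℝ) ^ k * (1 / (4 * 2 ^ m))) ≤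
        (A.card : ℝ) ^ 2 / 4 * (X.card : ℝ) ^ k := by
      calc _ ≤ (2 ^ m * A.card) * A.card * ((X.card : ℝ) ^ k * (1 / (4 * 2 ^ m))) := by gcongr
        _ = _ := by field_simp
    have hpos : 0 < S y := by
      have h1 := (abs_le.1 (hdiff.trans hb)).1
      have h2 : 0 < (A.card : ℝ) ^ 2 * (X.card : ℝ) ^ k := by positivity
      linarith
    obtain ⟨x, hx, h1⟩ := Finset.exists_ne_zero_of_sum_ne_zero hpos.ne'
    obtain ⟨a, ha, h2⟩ := Finset.exists_ne_zero_of_sum_ne_zero h1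
    obtain ⟨a', ha', h3⟩ := Finset.exists_ne_zero_of_sum_ne_zero h2
    have h4 : a + a' + y + ∑ i, x i ∈ A + A := by
      by_contra h; exact h3 (if_neg h)
    have h5 := hT x hx
    have h6 : (0 : ℝ) < (A.card : ℝ) ^ 2 / 2 := by positivity
    obtain ⟨b, hb, h7⟩ := Finset.exists_ne_zero_of_sum_ne_zero (h6.trans_le h5).ne'
    obtain ⟨b', hb', h8⟩ := Finset.exists_ne_zero_of_sum_ne_zero h7
    have h9 : b + b' + ∑ i, x i ∈ A + A := by
      by_contra h; exact h8 (if_neg h)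
    have e4 : 4 • A = (A + A) + (A + A) := by
      rw [show 4 = 2 + 2 from rfl, add_nsmul, two_nsmul]
    rw [e4]
    have : y = (((a + a' + y + ∑ i, x i) + (b + b')) - ((a + a') + (b + b' + ∑ i, x i))) := by
      abel
    rw [this]
    exact Finset.sub_mem_sub (Finset.add_mem_add h4 (Finset.add_mem_add hb hb'))
      (Finset.add_mem_add (Finset.add_mem_add ha ha') h9)

lemma model_aux (A : Finset ℤ) (N p : ℕ) (q : ZMod p) (r : ℤ → ℤ) (lo hi : ℤ)
    (hr : ∀ a ∈ A, ((r a : ℤ) : ZMod p) = q * (a : ZMod p) ∧ lo ≤ 12 * r a ∧ 12 * r a ≤ hi) (n : ℕ) :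
    ∀ z ∈ n • A.image (fun a => (a, ((r a : ℤ) : ZMod N))), ∃ T : ℤ, z.2 = (T : ZMod N) ∧
      (T : ZMod p) = q * (z.1 : ZMod p) ∧ n * lo ≤ 12 * T ∧ 12 * T ≤ n * hi ∧ z.1 ∈ n • A := by
  classical
  induction n with
  | zero =>
    intro z hz
    rw [zero_nsmul, Finset.mem_zero] at hz
    subst hz
    exact ⟨0, by simp⟩
  | succ n ih =>
    intro z hz
    rw [succ_nsmul, Finset.mem_add] at hz
    obtain ⟨u, hu, v, hv, rfl⟩ := hz
    obtain ⟨T, h1, h2, h3, h4, h5⟩ := ih u hu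
    obtain ⟨a, ha, rfl⟩ := Finset.mem_image.1 hv
    obtain ⟨g1, g2, g3⟩ := hr a ha
    refine ⟨T + r a, ?_, ?_, ?_, ?_, ?_⟩
    · simp [h1]
    · push_cast; rw [h2, g1]; simp; ring
    · push_cast; linarith
    · push_cast; linarith
    · rw [succ_nsmul]; exact Finset.add_mem_add h5 ha

lemma ruzsa_model (A : Finset ℤ) (hA : A.Nonempty) (N : ℕ)
    (hN : 4 * (12 • A - 12 • A).card ≤ N) :
    ∃ A' ⊆ A, A.card ≤ 12 * A'.card ∧ ∃ φ : ℤ → ZMod N,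
      ∀ z ∈ 12 • A'.image (fun a => (a, φ a)) - 12 • A'.image (fun a => (a, φ a)),
        (z.1 = 0 ↔ z.2 = 0) := by
  classical
  set D := 12 • A - 12 • A with hD
  have hDn : D.Nonempty := by
    have : (12 • A).Nonempty := hA.nsmul
    exact this.sub this
  have hDc := hDn.card_pos
  have hNpos : 0 < N := by omega
  obtain ⟨p, hpge, hp⟩ := Nat.exists_infinite_primes (2 * D.card + ∑ s ∈ D, s.natAbs + 1)
  have := Fact.mk hp
  set J : ℤ := ((p / N : ℕ) : ℤ) with hJ
  set bad : Finset (ZMod p) := (D ×ˢ Finset.Icc (-J) J).image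
    (fun w => ((N : ℤ) * w.2 : ℤ) * ((w.1 : ℤ) : ZMod p)⁻¹) with hbad
  have hbc : bad.card < Finset.card (Finset.univ : Finset (ZMod p)) := by
    rw [Finset.card_univ, ZMod.card]
    refine Finset.card_image_le.trans_lt ?_
    rw [Finset.card_product, Int.card_Icc]
    have h1 : (J + 1 - -J).toNat = 2 * (p / N) + 1 := by omega
    rw [h1]
    have h2 : N * (p / N) ≤ p := Nat.mul_div_le _ _
    have h3 : 4 * D.card * (p / N) ≤ p := (Nat.mul_le_mul_right _ hN).trans h2
    have h4 : D.card * (2 * (p / N) + 1) * 2 = 4 * D.card * (p / N) + 2 * D.card := by ring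
    omega
  obtain ⟨q, -, hq⟩ := Finset.exists_mem_notMem_of_card_lt_card hbc
  have hgood : ∀ s ∈ D, s ≠ 0 → ∀ j : ℤ, |j| ≤ J →
      q * (s : ZMod p) ≠ (((N : ℤ) * j : ℤ) : ZMod p) := by
    intro s hs hs0 j hj h
    apply hq
    rw [hbad, Finset.mem_image]
    refine ⟨(s, j), Finset.mem_product.2 ⟨hs, Finset.mem_Icc.2 (abs_le.1 hj)⟩, ?_⟩
    have hsp : (s : ZMod p) ≠ 0 := by
      rw [Ne, ZMod.intCast_zmod_eq_zero_iff_dvd]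
      intro hd
      have := Int.natAbs_dvd_natAbs.2 hd
      have h2 := Nat.le_of_dvd (Int.natAbs_pos.2 hs0) this
      have h3 := Finset.single_le_sum (f := fun s : ℤ => s.natAbs) (fun _ _ => Nat.zero_le _) hs
      simp at h2 h3
      omega
    rw [← h]
    field_simp
  set r : ℤ → ℤ := fun a => ((q * (a : ZMod p)).val : ℤ) with hr
  have hrp : ∀ a, r a < p := fun a => by
    have := ZMod.val_lt (q * (a : ZMod p))
    simp only [hr]; exact_mod_cast this
  have hr0 : ∀ a, 0 ≤ r a := fun a => Int.natCast_nonneg _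
  have hp0 : (0 : ℤ) < p := by exact_mod_cast hp.pos
  obtain ⟨j, hj, hjc⟩ := Finset.exists_le_card_fiber_of_nsmul_le_card_of_maps_to
    (s := A) (t := Finset.Ico (0 : ℤ) 12) (f := fun a => 12 * r a / p) (b := (A.card : ℚ) / 12)
    (by
      intro a _
      rw [Finset.mem_Ico]
      constructor
      · exact Int.ediv_nonneg (by have := hr0 a; omega) hp0.le
      · apply Int.ediv_lt_of_lt_mul hp0
        have := hrp a; omega)
    ⟨0, by simp⟩ (by simp; linarith)
  set A' := A.filter (fun a => 12 * r a / p = j) with hA'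
  refine ⟨A', Finset.filter_subset _ _, ?_, fun a => ((r a : ℤ) : ZMod N), ?_⟩
  · have : (A.card : ℚ) ≤ 12 * A'.card := by linarith
    exact_mod_cast this
  · have aux := model_aux A' N p q r (p * j) (p * j + (p - 1)) (by
      intro a ha
      have h1 := (Finset.mem_filter.1 ha).2
      refine ⟨?_, ?_, ?_⟩
      · simp [hr]
      · rw [← h1]; exact Int.mul_ediv_self_le hp0.ne'
      · have := Int.lt_mul_ediv_self_add (x := 12 * r a) hp0
        rw [h1] at this; linarith) 12
    intro z hz
    obtain ⟨u, hu, v, hv, rfl⟩ := Finset.mem_sub.1 hz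
    obtain ⟨T, h1, h2, h3, h4, h5⟩ := aux u hu
    obtain ⟨T', g1, g2, g3, g4, g5⟩ := aux v hv
    have hsub : 12 • A' ⊆ 12 • A := Finset.nsmul_subset_nsmul_left (Finset.filter_subset _ _)
    have hs : u.1 - v.1 ∈ D := Finset.sub_mem_sub (hsub h5) (hsub g5)
    have hT : |T - T'| < p := by
      rw [abs_lt]; push_cast at *; constructor <;> linarith
    have hq1 : ((T - T' : ℤ) : ZMod p) = q * ((u.1 - v.1 : ℤ) : ZMod p) := by
      push_cast; rw [h2, g2]; ring
    have hq2 : (u - v).2 = ((T - T' : ℤ) : ZMod N) := by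
      rw [Prod.snd_sub, h1, g1]; push_cast; rfl
    rw [hq2, Prod.fst_sub]
    constructor
    · intro h
      rw [h, Int.cast_zero, mul_zero, ZMod.intCast_zmod_eq_zero_iff_dvd] at hq1
      rw [Int.eq_zero_of_abs_lt_dvd hq1 hT]; simp
    · intro h
      by_contra hne
      rw [ZMod.intCast_zmod_eq_zero_iff_dvd] at h
      obtain ⟨i, hi⟩ := h
      rw [hi] at hq1
      refine hgood _ hs hne i ?_ hq1.symm
      rw [hJ]
      push_cast
      rw [Int.le_ediv_iff_mul_le (by exact_mod_cast hNpos)]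
      rw [hi, abs_mul, Nat.abs_cast] at hT
      linarith

lemma sum_single_add {r : ℕ} (l : Fin r → ℕ) (i : Fin r) (y : Fin r → ℤ) :
    ∑ j, (((l + Pi.single i 1 : Fin r → ℕ) j : ℕ) : ℤ) * y j = ∑ j, (l j : ℤ) * y j + y i := by
  simp [add_mul, Finset.sum_add_distrib, Pi.single_apply]

lemma lift_gap (N : ℕ) (Γ : Finset (ℤ × ZMod N))
    (hΓ : ∀ z ∈ 12 • Γ - 12 • Γ, (z.1 = 0 ↔ z.2 = 0)) (r : ℕ) (x : Fin r → ℤ) (L : Fin r → ℕ)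
    (hL : ∀ i, 0 < L i)
    (hbox : ∀ l : Fin r → ℕ, (∀ i, l i < L i) →
      ∃ s : ℤ, (s, ((∑ i, (l i : ℤ) * x i : ℤ) : ZMod N)) ∈ 4 • Γ - 4 • Γ)
    (hinj : ∀ l l' : Fin r → ℕ, (∀ i, l i < L i) → (∀ i, l' i < L i) →
      (N : ℤ) ∣ (∑ i, (l i : ℤ) * x i) - ∑ i, (l' i : ℤ) * x i → l = l') :
    ∃ y : Fin r → ℤ,
      (∀ l : Fin r → ℕ, (∀ i, l i < L i) →
        (∑ i, (l i : ℤ) * y i, ((∑ i, (l i : ℤ) * x i : ℤ) : ZMod N)) ∈ 4 • Γ - 4 • Γ) ∧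
      (∀ l l' : Fin r → ℕ, (∀ i, l i < L i) → (∀ i, l' i < L i) →
        ∑ i, (l i : ℤ) * y i = ∑ i, (l' i : ℤ) * y i → l = l') := by
  classical
  set F := 4 • Γ - 4 • Γ with hF
  have h12 : 12 • Γ = 4 • Γ + 4 • Γ + 4 • Γ := by
    rw [← add_nsmul, ← add_nsmul]
  have hFF : ∀ u ∈ F, ∀ v ∈ F, ∀ w ∈ F, u + v - w ∈ 12 • Γ - 12 • Γ := by
    intro u hu v hv w hw
    obtain ⟨a1, ha1, b1, hb1, rfl⟩ := Finset.mem_sub.1 hu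
    obtain ⟨a2, ha2, b2, hb2, rfl⟩ := Finset.mem_sub.1 hv
    obtain ⟨a3, ha3, b3, hb3, rfl⟩ := Finset.mem_sub.1 hw
    rw [h12, show a1 - b1 + (a2 - b2) - (a3 - b3) = (a1 + a2 + b3) - (b1 + b2 + a3) by abel]
    exact Finset.sub_mem_sub (Finset.add_mem_add (Finset.add_mem_add ha1 ha2) hb3)
      (Finset.add_mem_add (Finset.add_mem_add hb1 hb2) ha3)
  have h0F : (0 : ℤ × ZMod N) ∈ F := by
    obtain ⟨s, hs⟩ := hbox 0 hL
    obtain ⟨a, ha, b, hb, -⟩ := Finset.mem_sub.1 hs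
    have := Finset.sub_mem_sub ha ha
    rwa [sub_self] at this
  have hlift : ∀ i, ∃ s : ℤ, 2 ≤ L i → (s, ((x i : ℤ) : ZMod N)) ∈ F := by
    intro i
    by_cases h : 2 ≤ L i
    · obtain ⟨s, hs⟩ := hbox (Pi.single i 1) (by
        intro j
        by_cases hj : j = i
        · subst hj; simp; omega
        · simp [hj, hL])
      refine ⟨s, fun _ => ?_⟩
      simpa [Pi.single_apply] using hs
    · exact ⟨0, fun h' => absurd h' h⟩
  choose y hy using hlift
  have hmem : ∀ n : ℕ, ∀ l : Fin r → ℕ, ∑ i, l i = n → (∀ i, l i < L i) →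
        (∑ i, (l i : ℤ) * y i, ((∑ i, (l i : ℤ) * x i : ℤ) : ZMod N)) ∈ F := by
    intro n
    induction n with
    | zero =>
      intro l hl _
      have : ∀ i, l i = 0 := fun i => by
        have := Finset.sum_eq_zero_iff.1 hl i (Finset.mem_univ _); exact this
      simp only [this, Nat.cast_zero, zero_mul, Finset.sum_const_zero, Int.cast_zero]
      exact h0F
    | succ n ih =>
      intro l hl hlL
      have : ∃ i, l i ≠ 0 := by
        by_contra h
        push Not at h
        simp [h] at hl
      obtain ⟨i, hi⟩ := this
      obtain ⟨l', rfl⟩ : ∃ l' : Fin r → ℕ, l = l' + Pi.single i 1 := by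
        refine ⟨l - Pi.single i 1, ?_⟩
        ext j
        by_cases hj : j = i
        · subst hj; simp; omega
        · simp [hj]
      have hl'L : ∀ j, l' j < L j := fun j => lt_of_le_of_lt (by simp) (hlL j)
      have h1 := ih l' (by simp [Finset.sum_add_distrib, Pi.single_apply] at hl; exact hl) hl'L
      have h2 := hy i (by have := hlL i; simp at this; omega)
      obtain ⟨s, hs⟩ := hbox _ hlL
      have h3 := hΓ _ (hFF _ h1 _ h2 _ hs)
      rw [sum_single_add] at hs ⊢
      rw [sum_single_add] at h3
      have h4 : s = ∑ j, (l' j : ℤ) * y j + y i := by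
        have := h3.2 (by simp)
        simp at this
        linarith
      rw [sum_single_add, ← h4]
      exact hs
  refine ⟨y, fun l hl => hmem _ l rfl hl, ?_⟩
  intro l l' hl hl' h
  apply hinj l l' hl hl'
  have h1 := hΓ _ (hFF _ (hmem _ l rfl hl) _ h0F _ (hmem _ l' rfl hl'))
  have h2 := h1.1 (by simp [h])
  rw [← ZMod.intCast_zmod_eq_zero_iff_dvd]
  simpa using h2

lemma pluennecke_real (A : Finset ℤ) (hA : A.Nonempty) (K : ℝ)
    (h : ((A + A).card : ℝ) ≤ K * A.card) (a b : ℕ) :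
    ((a • A - b • A).card : ℝ) ≤ K ^ (a + b) * A.card := by
  have hAc : (0 : ℝ) < A.card := by exact_mod_cast hA.card_pos
  have h1 := Finset.pluennecke_ruzsa_inequality_nsmul_sub_nsmul_add hA A a b
  have h2 : ((a • A - b • A).card : ℝ) ≤ (((A + A).card : ℝ) / A.card) ^ (a + b) * A.card := by
    have := (NNRat.cast_le (K := ℝ)).2 h1
    push_cast at this
    exact this
  refine h2.trans ?_
  gcongr
  rwa [div_le_iff₀ hAc]

lemma char_close (N : ℕ) (l : AddChar (ZMod N) ℂ) (hl : ‖l 1‖ = 1) (z k : ℤ) :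
    ‖l ((z : ℤ) : ZMod N) - 1‖ ≤ 2 * Real.pi * |Complex.arg (l 1) / (2 * Real.pi) * z - k| := by
  have h1 : l ((z : ℤ) : ZMod N) = l 1 ^ z := by
    rw [← AddChar.map_zsmul_eq_zpow, zsmul_one]
  have h2 : l 1 = Complex.exp (Complex.arg (l 1) * Complex.I) := by
    have := Complex.norm_mul_exp_arg_mul_I (l 1)
    rw [hl, Complex.ofReal_one, one_mul] at this
    exact this.symm
  set θ := Complex.arg (l 1)
  have h3 : l 1 ^ z = Complex.exp (Complex.I * ((θ * z - 2 * Real.pi * k : ℝ) : ℂ)) := by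
    rw [h2, ← Complex.exp_int_mul, Complex.exp_eq_exp_iff_exists_int]
    exact ⟨k, by push_cast; ring⟩
  rw [h1, h3]
  refine (Real.norm_exp_I_mul_ofReal_sub_one_le).trans ?_
  rw [Real.norm_eq_abs]
  have hpi := Real.pi_pos
  rw [show θ * z - 2 * Real.pi * k = 2 * Real.pi * (θ / (2 * Real.pi) * z - k) by field_simp,
    abs_mul, abs_of_pos (by positivity : 0 < 2 * Real.pi)]

lemma image_snd_nsmul (N : ℕ) (Γ : Finset (ℤ × ZMod N)) (n : ℕ) :
    n • Γ.image Prod.snd = (n • Γ).image Prod.snd := by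
  classical
  induction n with
  | zero => rw [zero_nsmul, zero_nsmul]; rfl
  | succ n ih =>
    rw [succ_nsmul, succ_nsmul, ih]
    exact (Finset.image_add (AddMonoidHom.snd ℤ (ZMod N))).symm

lemma image_fst_nsmul (N : ℕ) (Γ : Finset (ℤ × ZMod N)) (n : ℕ) :
    n • Γ.image Prod.fst = (n • Γ).image Prod.fst := by
  classical
  induction n with
  | zero => rw [zero_nsmul, zero_nsmul]; rfl
  | succ n ih =>
    rw [succ_nsmul, succ_nsmul, ih]
    exact (Finset.image_add (AddMonoidHom.fst ℤ (ZMod N))).symm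

lemma find_gap (A : Finset ℤ) (hA : A.Nonempty) (K : ℝ)
    (hAK : ((A + A).card : ℝ) ≤ K * A.card) (m D : ℕ) (hm : 48 * K ^ 24 ≤ 2 ^ m)
    (hD : D = 8 * (512 * m * (m + 4) ^ 3 + 1)) :
    ∃ (r : ℕ) (y : Fin r → ℤ) (L : Fin r → ℕ), r ≤ D + 1 ∧ (∀ i, 0 < L i) ∧
      (∀ l : Fin r → ℕ, (∀ i, l i < L i) → ∑ i, (l i : ℤ) * y i ∈ 4 • A - 4 • A) ∧
      (∀ l l' : Fin r → ℕ, (∀ i, l i < L i) → (∀ i, l' i < L i) →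
        ∑ i, (l i : ℤ) * y i = ∑ i, (l' i : ℤ) * y i → l = l') ∧
      A.card ≤ 2 ^ ((9 + m + 4 * (D + 1)) * (D + 1)) * ∏ i, L i := by
  classical
  have hAc : (0 : ℝ) < A.card := by exact_mod_cast hA.card_pos
  set N := 4 * (12 • A - 12 • A).card with hN
  have hDn : (12 • A - 12 • A).Nonempty := by
    have : (12 • A).Nonempty := hA.nsmul
    exact this.sub this
  have hNpos : 0 < N := by have := hDn.card_pos; omega
  have : NeZero N := ⟨hNpos.ne'⟩
  obtain ⟨A', hA'A, hA'c, φ, hφ⟩ := ruzsa_model A hA N le_rfl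
  set Γ := A'.image (fun a => (a, φ a)) with hΓ
  have hA'n : A'.Nonempty := by
    rw [← Finset.card_pos]; have := hA.card_pos; omega
  have hΓn : Γ.Nonempty := hA'n.image _
  set B := Γ.image Prod.snd with hB
  have hBc : B.card = A'.card := by
    rw [hB, hΓ, Finset.image_image]
    apply Finset.card_image_of_injOn
    intro a ha b hb hab
    simp only [Function.comp] at hab
    have ha' : (a, φ a) ∈ Γ := Finset.mem_image_of_mem _ ha
    have hb' : (b, φ b) ∈ Γ := Finset.mem_image_of_mem _ hb
    obtain ⟨c, hc⟩ : (11 • Γ).Nonempty := hΓn.nsmul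
    have h1 : 12 • Γ = Γ + 11 • Γ := by rw [← succ_nsmul']
    have h2 := hφ (((a, φ a) + c) - ((b, φ b) + c)) (by
      rw [h1]
      exact Finset.sub_mem_sub (Finset.add_mem_add ha' hc) (Finset.add_mem_add hb' hc))
    have h3 := h2.2 (by simp [hab])
    simp at h3
    linarith
  have hBn : B.Nonempty := hΓn.image _
  have hcard : (Fintype.card (ZMod N) : ℝ) ≤ 2 ^ m * B.card := by
    rw [ZMod.card, hBc, hN]
    push_cast
    have h1 := pluennecke_real A hA K hAK 12 12
    norm_num at h1
    have h2 : (A.card : ℝ) ≤ 12 * A'.card := by exact_mod_cast hA'c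
    have hK : 0 ≤ K ^ 24 := Even.pow_nonneg (by decide) K
    calc _ ≤ 4 * (K ^ 24 * (12 * A'.card)) := by
          have := mul_le_mul_of_nonneg_left h2 hK
          linarith
      _ = 48 * K ^ 24 * A'.card := by ring
      _ ≤ _ := by gcongr
  obtain ⟨Λ, hΛc, hΛ⟩ := bogo B hBn m hcard
  rw [← hD] at hΛc
  set d := Λ.card with hd
  set e := Λ.equivFin with he
  set q := 64 * 2 ^ m * (d + 1) ^ 3 * 2 ^ (d + 1) with hq
  have hδpos : (0 : ℝ) < 1 / (64 * 2 ^ m * (d + 1)) := by positivity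
  obtain ⟨r, hr, x, L, hL, hbox, hinj, hbig⟩ := bohr_gap N hNpos d
    (fun j => Complex.arg ((e.symm j : AddChar (ZMod N) ℂ) 1) / (2 * Real.pi)) q (by positivity)
    (1 / (64 * 2 ^ m * (d + 1))) (by
      rw [div_lt_div_iff₀ (by positivity) (by norm_num)]
      have h1 : (1 : ℝ) ≤ 2 ^ m := one_le_pow₀ (by norm_num)
      have h2 : (0 : ℝ) ≤ d * 2 ^ m := by positivity
      nlinarith) (by
      rw [hq]; push_cast
      apply le_of_eq
      field_simp)
  have hbox' : ∀ l : Fin r → ℕ, (∀ i, l i < L i) →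
      ∃ s : ℤ, (s, ((∑ i, (l i : ℤ) * x i : ℤ) : ZMod N)) ∈ 4 • Γ - 4 • Γ := by
    intro l hl
    have h1 : ((∑ i, (l i : ℤ) * x i : ℤ) : ZMod N) ∈ 4 • B - 4 • B := by
      apply hΛ
      intro c hc
      obtain ⟨k, hk⟩ := hbox l hl (e ⟨c, hc⟩)
      rw [Equiv.symm_apply_apply] at hk
      refine (char_close N c (AddChar.norm_apply c 1) _ k).trans ?_
      calc _ ≤ 2 * Real.pi * (1 / (64 * 2 ^ m * (d + 1))) := by
            have := Real.pi_pos
            gcongr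
        _ ≤ 8 * (1 / (64 * 2 ^ m * (d + 1))) := by
            gcongr
            linarith [Real.pi_le_four]
        _ = _ := by field_simp; norm_num
    rw [hB, image_snd_nsmul] at h1
    obtain ⟨u, hu, v, hv, huv⟩ := Finset.mem_sub.1 h1
    obtain ⟨u', hu', rfl⟩ := Finset.mem_image.1 hu
    obtain ⟨v', hv', rfl⟩ := Finset.mem_image.1 hv
    refine ⟨u'.1 - v'.1, ?_⟩
    rw [← huv]
    exact Finset.sub_mem_sub hu' hv'
  obtain ⟨y, hy1, hy2⟩ := lift_gap N Γ hφ r x L hL hbox' hinj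
  refine ⟨r, y, L, hr.trans (by omega), hL, ?_, hy2, ?_⟩
  · intro l hl
    have h1 := hy1 l hl
    obtain ⟨u, hu, v, hv, huv⟩ := Finset.mem_sub.1 h1
    have h2 : 4 • A' ⊆ 4 • A := Finset.nsmul_subset_nsmul_left hA'A
    have h3 : Γ.image Prod.fst = A' := by
      rw [hΓ, Finset.image_image]; exact Finset.image_id
    have h4 : ∀ u ∈ 4 • Γ, u.1 ∈ 4 • A := by
      intro u hu
      apply h2
      rw [← h3, image_fst_nsmul]
      exact Finset.mem_image_of_mem _ hu
    have h5 : ∑ i, (l i : ℤ) * y i = u.1 - v.1 := by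
      rw [← Prod.fst_sub, huv]
    rw [h5]
    exact Finset.sub_mem_sub (h4 u hu) (h4 v hv)
  · have h1 : A.card ≤ N := by
      obtain ⟨c, hc⟩ : (11 • A - 12 • A).Nonempty := (hA.nsmul).sub (hA.nsmul)
      have h2 : 12 • A - 12 • A = A + (11 • A - 12 • A) := by
        rw [show 12 • A = A + 11 • A by rw [← succ_nsmul'], add_sub_assoc]
      have h3 : A.card ≤ (12 • A - 12 • A).card := by
        rw [h2]; exact Finset.card_le_card_add_right ⟨c, hc⟩
      omega
    refine (h1.trans hbig).trans (Nat.mul_le_mul_right _ ?_)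
    have hdD : d ≤ D := hΛc
    calc (8 * q) ^ (d + 1) ≤ (2 ^ (9 + m + 4 * (D + 1))) ^ (d + 1) := by
          apply Nat.pow_le_pow_left
          have h5 : d + 1 ≤ 2 ^ (d + 1) := Nat.lt_two_pow_self.le
          calc 8 * q = 2 ^ 9 * 2 ^ m * (d + 1) ^ 3 * 2 ^ (d + 1) := by rw [hq]; ring
            _ ≤ 2 ^ 9 * 2 ^ m * (2 ^ (d + 1)) ^ 3 * 2 ^ (d + 1) := by gcongr
            _ = 2 ^ (9 + m + 4 * (d + 1)) := by rw [← pow_mul]; simp only [← pow_add]; congr 1; ring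
            _ ≤ _ := by
              apply Nat.pow_le_pow_right (by norm_num); omega
      _ = 2 ^ ((9 + m + 4 * (D + 1)) * (d + 1)) := by rw [← pow_mul]
      _ ≤ _ := by
        apply Nat.pow_le_pow_right (by norm_num)
        apply Nat.mul_le_mul_left; omega

/-- `S` is contained in a progression of dimension at most `d` and size at most `M`. -/
def InGAP (S : Finset ℤ) (d M : ℕ) : Prop :=
  ∃ d' ≤ d, ∃ (a : ℤ) (x : Fin d' → ℤ) (L : Fin d' → ℕ), (∀ i, 0 < L i) ∧
    (∀ z ∈ S, ∃ l : Fin d' → ℕ, (∀ i, l i < L i) ∧ z = a + ∑ i, (l i : ℤ) * x i) ∧ ∏ i, L i ≤ M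

lemma InGAP.mono {S T : Finset ℤ} {d d' M M' : ℕ} (h : InGAP T d M) (hST : S ⊆ T) (hd : d ≤ d')
    (hM : M ≤ M') : InGAP S d' M' := by
  obtain ⟨e, he, a, x, L, h1, h2, h3⟩ := h
  exact ⟨e, he.trans hd, a, x, L, h1, fun z hz => h2 z (hST hz), h3.trans hM⟩

lemma InGAP.add {S T : Finset ℤ} {d d' M M' : ℕ} (h : InGAP S d M) (h' : InGAP T d' M') :
    InGAP (S + T) (d + d') (M * M') := by
  obtain ⟨e, he, a, x, L, h1, h2, h3⟩ := h
  obtain ⟨e', he', a', x', L', h1', h2', h3'⟩ := h'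
  refine ⟨e + e', by omega, a + a', Fin.append x x', Fin.append L L', ?_, ?_, ?_⟩
  · intro i
    refine Fin.addCases (fun i => ?_) (fun i => ?_) i
    · simpa using h1 i
    · simpa using h1' i
  · intro z hz
    obtain ⟨s, hs, t, ht, rfl⟩ := Finset.mem_add.1 hz
    obtain ⟨l, hl, rfl⟩ := h2 s hs
    obtain ⟨l', hl', rfl⟩ := h2' t ht
    refine ⟨Fin.append l l', ?_, ?_⟩
    · intro i
      refine Fin.addCases (fun i => ?_) (fun i => ?_) i
      · simpa using hl i
      · simpa using hl' i
    · rw [Fin.sum_univ_add]; simp; ring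
  · rw [Fin.prod_univ_add]; simp
    exact Nat.mul_le_mul h3 h3'

lemma InGAP.neg {S : Finset ℤ} {d M : ℕ} (h : InGAP S d M) : InGAP (-S) d M := by
  obtain ⟨e, he, a, x, L, h1, h2, h3⟩ := h
  refine ⟨e, he, -a, -x, L, h1, ?_, h3⟩
  intro z hz
  obtain ⟨l, hl, h⟩ := h2 _ (Finset.mem_neg'.1 hz)
  refine ⟨l, hl, ?_⟩
  simp; linarith

lemma inGAP_finite (S : Finset ℤ) : InGAP S S.card (2 ^ S.card) := by
  refine ⟨S.card, le_rfl, 0, fun i => (S.equivFin.symm i : ℤ), fun _ => 2, by simp, ?_, by simp⟩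
  intro z hz
  refine ⟨Pi.single (S.equivFin ⟨z, hz⟩) 1, ?_, ?_⟩
  · intro i
    by_cases h : i = S.equivFin ⟨z, hz⟩ <;> simp [h]
  · simp [Pi.single_apply]

lemma greedy (A Q : Finset ℤ) (hQ : Q.Nonempty) (c : ℕ) :
    (∃ S ⊆ A, S.card = c ∧ (Q + S).card = c * Q.card) ∨
    (∃ S ⊆ A, S.card < c ∧ A ⊆ (Q - Q) + S) := by
  classical
  induction c with
  | zero => left; exact ⟨∅, by simp, by simp, by simp⟩
  | succ c ih =>
    rcases ih with ⟨S, hS, hc, hQS⟩ | ⟨S, hS, hc, h⟩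
    · by_cases h : A ⊆ (Q - Q) + S
      · right; exact ⟨S, hS, by omega, h⟩
      · left
        obtain ⟨a, ha, haS⟩ := Finset.not_subset.1 h
        have key : ∀ u ∈ Q, ∀ v ∈ Q, ∀ s ∈ S, u + s ≠ v + a := by
          intro u hu v hv s hs h
          apply haS
          have : a = (u - v) + s := by linarith
          rw [this]
          exact Finset.add_mem_add (Finset.sub_mem_sub hu hv) hs
        have haS' : a ∉ S := fun h => by
          obtain ⟨u, hu⟩ := hQ
          exact key u hu u hu a h rfl
        refine ⟨insert a S, Finset.insert_subset ha hS, ?_, ?_⟩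
        · rw [Finset.card_insert_of_notMem haS', hc]
        · rw [Finset.insert_eq, Finset.add_union, Finset.card_union_of_disjoint, hQS]
          · rw [Finset.card_add_singleton]; ring
          · rw [Finset.disjoint_left]
            intro z hz hz'
            obtain ⟨v, hv, b, hb, rfl⟩ := Finset.mem_add.1 hz
            rw [Finset.mem_singleton] at hb
            subst hb
            obtain ⟨u, hu, s, hs, h⟩ := Finset.mem_add.1 hz'
            exact key u hu v hv s hs h
    · right; exact ⟨S, hS, by omega, h⟩

lemma chang_cover (A : Finset ℤ) (hA : A.Nonempty) (K : ℝ) (hK : 1 ≤ K)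
    (hAK : ((A + A).card : ℝ) ≤ K * A.card) (c : ℕ) (hc : 2 * K ≤ c) (t : ℕ) :
    ∀ (i : ℕ) (Q : Finset ℤ) (d M : ℕ), Q.Nonempty → Q ⊆ (4 + i) • A - 4 • A →
      InGAP (Q - Q) d M → K ^ (8 + i + t) * A.card < (2 * K) ^ t * Q.card →
      InGAP A (d + 2 * (t + 1) * c) (M * 4 ^ ((t + 1) * c)) := by
  classical
  have hAc : (0 : ℝ) < A.card := by exact_mod_cast hA.card_pos
  induction t with
  | zero =>
    intro i Q d M hQ hQA _ h
    exfalso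
    have h1 := pluennecke_real A hA K hAK (4 + i) 4
    have h2 : (Q.card : ℝ) ≤ ((4 + i) • A - 4 • A).card := by
      exact_mod_cast Finset.card_le_card hQA
    rw [show 4 + i + 4 = 8 + i + 0 by ring] at h1
    linarith
  | succ t ih =>
    intro i Q d M hQ hQA hG h
    rcases greedy A Q hQ c with ⟨S, hS, hSc, hQS⟩ | ⟨S, hS, hSc, hcov⟩
    · have hc0 : 0 < c := by
        have : (0 : ℝ) < c := by linarith
        exact_mod_cast this
      have hSn : S.Nonempty := by rw [← Finset.card_pos]; omega
      have hg := inGAP_finite S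
      have hsub : InGAP (S - S) (2 * c) (4 ^ c) := by
        have := hg.add hg.neg
        rw [← sub_eq_add_neg, hSc, ← mul_pow, ← two_mul] at this
        exact this
      have := ih (i + 1) (Q + S) (d + 2 * c) (M * 4 ^ c) (hQ.add hSn) ?_ ?_ ?_
      · refine this.mono subset_rfl ?_ ?_
        · apply le_of_eq; ring
        · apply le_of_eq
          rw [mul_assoc, ← pow_add]; congr 2; ring
      · rw [← add_assoc, succ_nsmul, show (4 + i) • A + A - 4 • A = ((4 + i) • A - 4 • A) + A by
          rw [sub_eq_add_neg, sub_eq_add_neg, add_right_comm]]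
        exact Finset.add_subset_add hQA hS
      · have e : Q + S - (Q + S) = (Q - Q) + (S - S) := by
          rw [add_sub_add_comm]
        rw [e]; exact hG.add hsub
      · rw [hQS]
        push_cast
        calc K ^ (8 + (i + 1) + t) * A.card = K ^ (8 + i + (t + 1)) * A.card := by
              congr 2; ring
          _ < (2 * K) ^ (t + 1) * Q.card := h
          _ = (2 * K) ^ t * (2 * K * Q.card) := by ring
          _ ≤ _ := by gcongr
    · have h1 := (hG.add (inGAP_finite S))
      refine h1.mono hcov ?_ ?_
      · have : c ≤ (t + 1 + 1) * c := Nat.le_mul_of_pos_left _ (by omega)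
        nlinarith
      · apply Nat.mul_le_mul_left
        calc 2 ^ S.card ≤ 4 ^ S.card := Nat.pow_le_pow_left (by norm_num) _
          _ ≤ _ := by
            apply Nat.pow_le_pow_right (by norm_num)
            have : c ≤ (t + 1 + 1) * c := Nat.le_mul_of_pos_left _ (by omega)
            omega

lemma freiman_nat (A : Finset ℤ) (hA : A.Nonempty) (K : ℝ) (hK : 2 ≤ K)
    (hAK : ((A + A).card : ℝ) ≤ K * A.card) (m D t c : ℕ) (hm : 48 * K ^ 24 ≤ 2 ^ m)
    (hD : D = 8 * (512 * m * (m + 4) ^ 3 + 1))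
    (ht : t = m + (9 + m + 4 * (D + 1)) * (D + 1)) (hc : 2 * K ≤ c) :
    InGAP A (D + 1 + m + 2 * (t + 1) * c) (2 ^ (D + 1 + m + 2 * (t + 1) * c) * A.card) := by
  classical
  have hAc : (0 : ℝ) < A.card := by exact_mod_cast hA.card_pos
  obtain ⟨r, y, L, hr, hL, hmem, hinj, hbig⟩ := find_gap A hA K hAK m D hm hD
  set box := Fintype.piFinset (fun i => Finset.range (L i)) with hbox
  have hb : ∀ l, l ∈ box ↔ ∀ i, l i < L i := by intro l; simp [hbox]
  set P := box.image (fun l => ∑ i, (l i : ℤ) * y i) with hP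
  have hPc : P.card = ∏ i, L i := by
    rw [hP, Finset.card_image_of_injOn]
    · simp [hbox]
    · intro l hl l' hl' h
      exact hinj l l' ((hb l).1 hl) ((hb l').1 hl') h
  have hPn : P.Nonempty := by
    refine ⟨_, Finset.mem_image_of_mem _ ((hb 0).2 hL)⟩
  have hPA : P ⊆ (4 + 0) • A - 4 • A := by
    intro z hz
    obtain ⟨l, hl, rfl⟩ := Finset.mem_image.1 hz
    exact hmem l ((hb l).1 hl)
  have hPP : InGAP (P - P) (D + 1) (2 ^ (D + 1) * P.card) := by
    refine ⟨r, hr, -∑ i, (L i : ℤ) * y i, y, fun i => 2 * L i, fun i => Nat.mul_pos (by norm_num) (hL i), ?_, ?_⟩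
    · intro z hz
      obtain ⟨u, hu, v, hv, rfl⟩ := Finset.mem_sub.1 hz
      obtain ⟨l, hl, rfl⟩ := Finset.mem_image.1 hu
      obtain ⟨l', hl', rfl⟩ := Finset.mem_image.1 hv
      have h1 := (hb l).1 hl
      have h2 := (hb l').1 hl'
      refine ⟨fun i => l i + L i - l' i, fun i => ?_, ?_⟩
      · have := h1 i; have := h2 i; simp only; omega
      · have h3 : ∀ i, ((l i + L i - l' i : ℕ) : ℤ) * y i =
            (l i : ℤ) * y i + L i * y i - l' i * y i := by
          intro i
          rw [Nat.cast_sub (by have := h2 i; omega)]; push_cast; ring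
        simp only [h3]
        rw [Finset.sum_sub_distrib, Finset.sum_add_distrib]; ring
    · rw [Finset.prod_mul_distrib, hPc]
      simp
      apply Nat.mul_le_mul_right
      exact Nat.pow_le_pow_right (by norm_num) hr
  have hK8 : K ^ 8 < 2 ^ m := by
    have h1 : K ^ 8 ≤ K ^ 24 := pow_le_pow_right₀ (by linarith) (by norm_num)
    have h2 : 0 < K ^ 8 := by positivity
    linarith
  have hPle : (P.card : ℝ) ≤ 2 ^ m * A.card := by
    have h1 := pluennecke_real A hA K hAK 4 4
    have h2 : (P.card : ℝ) ≤ (4 • A - 4 • A).card := by exact_mod_cast Finset.card_le_card hPA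
    norm_num at h1
    calc _ ≤ K ^ 8 * A.card := h2.trans h1
      _ ≤ _ := by gcongr
  have hPle' : P.card ≤ 2 ^ m * A.card := by exact_mod_cast hPle
  have := chang_cover A hA K (by linarith) hAK c hc t 0 P _ _ hPn hPA hPP (by
    rw [← hPc] at hbig
    have h1 : (A.card : ℝ) ≤ 2 ^ ((9 + m + 4 * (D + 1)) * (D + 1)) * P.card := by
      exact_mod_cast hbig
    calc K ^ (8 + 0 + t) * A.card = K ^ t * (K ^ 8 * A.card) := by rw [add_zero, pow_add]; ring
      _ < K ^ t * (2 ^ m * A.card) := by gcongr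
      _ ≤ K ^ t * (2 ^ m * (2 ^ ((9 + m + 4 * (D + 1)) * (D + 1)) * P.card)) := by gcongr
      _ = (2 * K) ^ t * P.card := by
        rw [mul_pow, ← mul_assoc (2 ^ m : ℝ), ← pow_add, ← ht]; ring)
  refine this.mono subset_rfl (by omega) ?_
  calc 2 ^ (D + 1) * P.card * 4 ^ ((t + 1) * c) ≤
      2 ^ (D + 1) * (2 ^ m * A.card) * 4 ^ ((t + 1) * c) := by gcongr
    _ = _ := by
      rw [show (4 : ℕ) = 2 ^ 2 by norm_num, ← pow_mul, ← mul_assoc 2 (t + 1) c]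
      simp only [pow_add, mul_assoc]
      ring

lemma param_bound (m D t : ℕ) (hm : 1 ≤ m) (hD : D = 8 * (512 * m * (m + 4) ^ 3 + 1))
    (ht : t = m + (9 + m + 4 * (D + 1)) * (D + 1)) :
    D + 1 + m ≤ 10 ^ 7 * m ^ 8 ∧ t + 1 ≤ 10 ^ 13 * m ^ 8 := by
  have h4 : m ≤ m ^ 4 := Nat.le_self_pow (by norm_num) m
  have h48 : m ^ 4 ≤ m ^ 8 := Nat.pow_le_pow_right hm (by norm_num)
  have h1 : 1 ≤ m ^ 4 := Nat.one_le_pow _ _ hm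
  have hD1 : D + 1 ≤ 10 ^ 6 * m ^ 4 := by
    have h2 : (m + 4) ^ 3 ≤ (5 * m) ^ 3 := Nat.pow_le_pow_left (by omega) 3
    have h3 : m * (m + 4) ^ 3 ≤ 125 * m ^ 4 := by
      calc _ ≤ m * (5 * m) ^ 3 := Nat.mul_le_mul_left _ h2
        _ = _ := by ring
    rw [hD, mul_assoc 512]
    omega
  refine ⟨by omega, ?_⟩
  have h5 : (9 + m + 4 * (D + 1)) * (D + 1) ≤ (5 * 10 ^ 6 * m ^ 4) * (10 ^ 6 * m ^ 4) :=
    Nat.mul_le_mul (by omega) hD1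
  have h6 : (5 * 10 ^ 6 * m ^ 4) * (10 ^ 6 * m ^ 4) = 5 * 10 ^ 12 * m ^ 8 := by ring
  rw [h6] at h5
  omega

lemma log_bound (K : ℝ) (hK : 2 ≤ K) :
    K * Real.log K ^ 8 ≤ 7 ^ 5 * (K ^ ((7 : ℝ) / 4) * Real.log K ^ 3) := by
  have hK0 : 0 < K := by linarith
  have hl : 0 < Real.log K := Real.log_pos (by linarith)
  have h1 := Real.log_le_rpow_div hK0.le (show (0 : ℝ) < 3 / 20 by norm_num)
  have h2 : Real.log K ≤ 7 * K ^ ((3 : ℝ) / 20) := by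
    refine h1.trans ?_
    have := Real.rpow_pos_of_pos hK0 ((3 : ℝ) / 20)
    rw [div_le_iff₀ (by norm_num)]
    linarith
  have h3 : (K ^ ((3 : ℝ) / 20)) ^ 5 = K ^ ((3 : ℝ) / 4) := by
    rw [← Real.rpow_mul_natCast hK0.le]; norm_num
  have h4 : K ^ ((7 : ℝ) / 4) = K * K ^ ((3 : ℝ) / 4) := by
    rw [← Real.rpow_one_add' hK0.le (by norm_num)]; norm_num
  calc K * Real.log K ^ 8 = K * Real.log K ^ 5 * Real.log K ^ 3 := by ring
    _ ≤ K * (7 * K ^ ((3 : ℝ) / 20)) ^ 5 * Real.log K ^ 3 := by gcongr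
    _ = _ := by rw [mul_pow, h3, h4]; ring

/-- **Improved Freiman theorem.** There is an absolute constant `C > 0` such that any finite
nonempty `A ⊆ ℤ` with `|A + A| ≤ K|A|` (for `K ≥ 2`) is contained in a multidimensional
arithmetic progression of dimension at most `C K^{7/4} (log K)^3` and size at most
`exp(C K^{7/4} (log K)^3) |A|`. -/
theorem improved_freiman :
    ∃ C : ℝ, 0 < C ∧
      ∀ (A : Finset ℤ) (K : ℝ), A.Nonempty → 2 ≤ K →
        ((A + A).card : ℝ) ≤ K * A.card →
        ∃ (d : ℕ) (a : ℤ) (x : Fin d → ℤ) (L : Fin d → ℕ),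
          (∀ i, 0 < L i) ∧
          (∀ z ∈ A, ∃ l : Fin d → ℕ, (∀ i, l i < L i) ∧
            z = a + ∑ i, (l i : ℤ) * x i) ∧
          (d : ℝ) ≤ C * K ^ ((7 : ℝ) / 4) * (Real.log K) ^ 3 ∧
          (∏ i, (L i : ℝ)) ≤ Real.exp (C * K ^ ((7 : ℝ) / 4) * (Real.log K) ^ 3) * A.card := by
  refine ⟨10 ^ 14 * 46 ^ 8 * 7 ^ 5, by positivity, ?_⟩
  intro A K hA hK hAK
  have hK0 : 0 < K := by linarith
  have hl2 : 0.69 < Real.log 2 := by linarith [Real.log_two_gt_d9]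
  have hlK : Real.log 2 ≤ Real.log K := Real.log_le_log (by norm_num) hK
  have hlK0 : 0 < Real.log K := by linarith
  have hl20 : 0 < Real.log 2 := by linarith
  set m := ⌈30 * Real.log K / Real.log 2⌉₊ with hm
  have hm1 : 1 ≤ m := Nat.one_le_ceil_iff.2 (by positivity)
  have hmle : (m : ℝ) ≤ 46 * Real.log K := by
    have h1 := Nat.ceil_lt_add_one (show 0 ≤ 30 * Real.log K / Real.log 2 by positivity)
    have h2 : 30 * Real.log K / Real.log 2 ≤ 44 * Real.log K := by
      rw [div_le_iff₀ (by positivity)]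
      nlinarith
    linarith
  have hm2 : 48 * K ^ 24 ≤ 2 ^ m := by
    have h1 : (48 : ℝ) ≤ K ^ 6 := by
      calc (48 : ℝ) ≤ 2 ^ 6 := by norm_num
        _ ≤ _ := by gcongr
    have h2 : 48 * K ^ 24 ≤ K ^ 30 := by
      calc _ ≤ K ^ 6 * K ^ 24 := by gcongr
        _ = _ := by ring
    refine h2.trans ?_
    have h3 : 30 * Real.log K / Real.log 2 ≤ m := Nat.le_ceil _
    rw [div_le_iff₀ (by positivity)] at h3
    rw [← Real.log_le_log_iff (by positivity) (by positivity), Real.log_pow, Real.log_pow]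
    exact_mod_cast h3
  set c := ⌈2 * K⌉₊ with hc
  have hc1 : 2 * K ≤ c := Nat.le_ceil _
  have hc2 : (c : ℝ) ≤ 3 * K := by
    have := Nat.ceil_lt_add_one (show 0 ≤ 2 * K by positivity)
    linarith
  obtain ⟨D, hD⟩ : ∃ D, D = 8 * (512 * m * (m + 4) ^ 3 + 1) := ⟨_, rfl⟩
  obtain ⟨t, ht⟩ : ∃ t, t = m + (9 + m + 4 * (D + 1)) * (D + 1) := ⟨_, rfl⟩
  obtain ⟨b1, b2⟩ := param_bound m D t hm1 hD ht
  obtain ⟨d, hd, a, x, L, h1, h2, h3⟩ := freiman_nat A hA K hK hAK m D t c hm2 hD ht hc1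
  clear_value m c
  set E := D + 1 + m + 2 * (t + 1) * c with hE
  have hEb : (E : ℝ) ≤ 10 ^ 14 * 46 ^ 8 * 7 ^ 5 * K ^ ((7 : ℝ) / 4) * (Real.log K) ^ 3 := by
    have b1' : ((D : ℝ) + 1 + m) ≤ 10 ^ 7 * (m : ℝ) ^ 8 := by exact_mod_cast b1
    have b2' : ((t : ℝ) + 1) ≤ 10 ^ 13 * (m : ℝ) ^ 8 := by exact_mod_cast b2
    have hm8 : (0 : ℝ) ≤ (m : ℝ) ^ 8 := by positivity
    have hEc : (E : ℝ) = D + 1 + m + 2 * (t + 1) * c := by rw [hE]; push_cast; ring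
    calc (E : ℝ) ≤ 10 ^ 7 * (m : ℝ) ^ 8 + 2 * (10 ^ 13 * (m : ℝ) ^ 8) * (3 * K) := by
          rw [hEc]; gcongr
      _ ≤ 10 ^ 14 * ((m : ℝ) ^ 8 * K) := by nlinarith
      _ ≤ 10 ^ 14 * ((46 * Real.log K) ^ 8 * K) := by gcongr
      _ = 10 ^ 14 * 46 ^ 8 * (K * Real.log K ^ 8) := by ring
      _ ≤ 10 ^ 14 * 46 ^ 8 * (7 ^ 5 * (K ^ ((7 : ℝ) / 4) * Real.log K ^ 3)) := by
          exact mul_le_mul_of_nonneg_left (log_bound K hK) (by positivity)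
      _ = _ := by ring
  refine ⟨d, a, x, L, h1, h2, ?_, ?_⟩
  · refine le_trans ?_ hEb
    exact_mod_cast hd
  · have h4 : (∏ i, (L i : ℝ)) ≤ 2 ^ E * A.card := by exact_mod_cast h3
    refine h4.trans ?_
    gcongr
    calc (2 : ℝ) ^ E ≤ Real.exp 1 ^ E := by
          gcongr; linarith [Real.add_one_le_exp (1 : ℝ)]
      _ = Real.exp E := by rw [← Real.exp_nat_mul, mul_one]
      _ ≤ _ := Real.exp_le_exp.2 hEb
end

section
/- There is an absolute constant c > 0 with the following property. Let A ⊆ ℝ be a finite set with |A| ≥ 16 and let α ∈ ℝ be transcendental over ℚ. Then |A + α·A| ≥ c·|A|·(log |A|)^{4/3} / (log log |A|)^{8/3}. -/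
section
open Finset Pointwise

/-- one-dimensional layer-cake inequality -/
theorem kl_layer (k : ℕ) : ∀ (X Y : Finset ℚ) (f g h : ℚ → ℝ) (s : ℝ), X.card + Y.card ≤ k →
    (∀ x ∈ X, 0 ≤ f x) → (∀ y ∈ Y, 0 ≤ g y) →
    (∃ x ∈ X, f x = s) → (∃ y ∈ Y, g y = s) → (∀ x ∈ X, f x ≤ s) → (∀ y ∈ Y, g y ≤ s) →
    (∀ x ∈ X, ∀ y ∈ Y, min (f x) (g y) ≤ h (x + y)) →
    ∑ x ∈ X, f x + ∑ y ∈ Y, g y - s ≤ ∑ z ∈ X + Y, h z := by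
  induction k with
  | zero =>
    intro X Y f g h s hk _ _ hX
    obtain ⟨x, hx, _⟩ := hX
    have : 0 < X.card := card_pos.2 ⟨x, hx⟩
    omega
  | succ k ih =>
    intro X Y f g h s hk hf hg hX hY hfs hgs hh
    obtain ⟨x₀, hx₀, hfx₀⟩ := hX
    obtain ⟨y₀, hy₀, hgy₀⟩ := hY
    obtain ⟨x₁, hx₁, hm₁⟩ := exists_min_image X f ⟨x₀, hx₀⟩
    obtain ⟨y₁, hy₁, hm₂⟩ := exists_min_image Y g ⟨y₀, hy₀⟩
    set m := min (f x₁) (g y₁) with hm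
    have hm0 : 0 ≤ m := le_min (hf _ hx₁) (hg _ hy₁)
    have hfm : ∀ x ∈ X, m ≤ f x := fun x hx => (min_le_left _ _).trans (hm₁ x hx)
    have hgm : ∀ y ∈ Y, m ≤ g y := fun x hx => (min_le_right _ _).trans (hm₂ x hx)
    have hcd : X.card + Y.card ≤ (X + Y).card + 1 := by
      have := cauchy_davenport_add_of_linearOrder_isCancelAdd (s := X) (t := Y) ⟨x₀, hx₀⟩ ⟨y₀, hy₀⟩
      omega
    have hcd' : (X.card : ℝ) + Y.card ≤ (X + Y).card + 1 := by exact_mod_cast hcd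
    have hhm : ∀ z ∈ X + Y, m ≤ h z := by
      intro z hz
      obtain ⟨x, hx, y, hy, rfl⟩ := mem_add.1 hz
      exact (le_min (hfm x hx) (hgm y hy)).trans (hh x hx y hy)
    have e1 : ∑ x ∈ X, f x = ∑ x ∈ X, (f x - m) + X.card * m := by
      simp [sum_sub_distrib]
    have e2 : ∑ x ∈ Y, g x = ∑ x ∈ Y, (g x - m) + Y.card * m := by
      simp [sum_sub_distrib]
    have e3 : ∑ x ∈ X + Y, h x = ∑ x ∈ X + Y, (h x - m) + (X + Y).card * m := by
      simp [sum_sub_distrib]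
    have e4 : ((X.card : ℝ) + Y.card) * m ≤ ((X + Y).card + 1) * m := by gcongr
    suffices H : ∑ x ∈ X, (f x - m) + ∑ x ∈ Y, (g x - m) - (s - m) ≤ ∑ x ∈ X + Y, (h x - m) by
      rw [e1, e2, e3]; linarith
    have hms : m ≤ s := by rw [← hfx₀]; exact hfm _ hx₀
    rcases eq_or_lt_of_le hms with hms | hms
    · have a1 : ∑ x ∈ X, (f x - m) = 0 := sum_eq_zero fun x hx => by
        have := hfs x hx; have := hfm x hx; linarith
      have a2 : ∑ x ∈ Y, (g x - m) = 0 := sum_eq_zero fun x hx => by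
        have := hgs x hx; have := hgm x hx; linarith
      have a3 : 0 ≤ ∑ x ∈ X + Y, (h x - m) := sum_nonneg fun z hz => by
        have := hhm z hz; linarith
      linarith
    · set X' := X.filter (fun x => m < f x)
      set Y' := Y.filter (fun x => m < g x)
      have b1 : ∑ x ∈ X, (f x - m) = ∑ x ∈ X', (f x - m) := by
        symm; apply sum_subset (filter_subset _ _)
        intro x hx hx'
        have := hfm x hx
        simp [hx] at hx'; linarith
      have b2 : ∑ x ∈ Y, (g x - m) = ∑ x ∈ Y', (g x - m) := by
        symm; apply sum_subset (filter_subset _ _)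
        intro x hx hx'
        have := hgm x hx
        simp [hx] at hx'; linarith
      have b3 : ∑ x ∈ X' + Y', (h x - m) ≤ ∑ x ∈ X + Y, (h x - m) := by
        apply sum_le_sum_of_subset_of_nonneg
        · exact add_subset_add (filter_subset _ _) (filter_subset _ _)
        · intro z hz _; have := hhm z hz; linarith
      have hc : X'.card + Y'.card ≤ k := by
        have c1 : X'.card ≤ X.card := card_filter_le _ _
        have c2 : Y'.card ≤ Y.card := card_filter_le _ _
        rcases min_choice (f x₁) (g y₁) with hc | hc
        · have : X'.card < X.card := by
            apply card_lt_card
            refine (filter_ssubset).2 ⟨x₁, hx₁, ?_⟩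
            rw [hm, hc]; simp
          omega
        · have : Y'.card < Y.card := by
            apply card_lt_card
            refine (filter_ssubset).2 ⟨y₁, hy₁, ?_⟩
            rw [hm, hc]; simp
          omega
      rw [b1, b2]
      refine le_trans ?_ b3
      apply ih X' Y' (fun x => f x - m) (fun x => g x - m) (fun x => h x - m) (s - m) hc
      · intro x hx; have := (mem_filter.1 hx).2; linarith
      · intro x hx; have := (mem_filter.1 hx).2; linarith
      · exact ⟨x₀, mem_filter.2 ⟨hx₀, by rw [hfx₀]; exact hms⟩, by rw [hfx₀]⟩
      · exact ⟨y₀, mem_filter.2 ⟨hy₀, by rw [hgy₀]; exact hms⟩, by rw [hgy₀]⟩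
      · intro x hx; have := hfs x (mem_filter.1 hx).1; linarith
      · intro x hx; have := hgs x (mem_filter.1 hx).1; linarith
      · intro x hx y hy
        have := hh x (mem_filter.1 hx).1 y (mem_filter.1 hy).1
        rw [min_sub_sub_right]; linarith

/-- multiplicative form -/
theorem kl_pl (X Y : Finset ℚ) (f g h : ℚ → ℝ) (a b : ℝ) (ha : 0 < a) (hb : 0 < b)
    (hf : ∀ x ∈ X, 0 ≤ f x) (hg : ∀ y ∈ Y, 0 ≤ g y)
    (hX : ∃ x ∈ X, f x = a) (hY : ∃ y ∈ Y, g y = b) (hfs : ∀ x ∈ X, f x ≤ a)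
    (hgs : ∀ y ∈ Y, g y ≤ b) (hh0 : ∀ z, 0 ≤ h z)
    (hh : ∀ x ∈ X, ∀ y ∈ Y, f x * g y ≤ h (x + y) ^ 2) :
    (2 * ∑ x ∈ X, f x - a) * (2 * ∑ y ∈ Y, g y - b) ≤ (∑ z ∈ X + Y, h z) ^ 2 := by
  set r := Real.sqrt (a * b) with hr
  have hr0 : 0 < r := Real.sqrt_pos.2 (mul_pos ha hb)
  have hr2 : r ^ 2 = a * b := Real.sq_sqrt (mul_pos ha hb).le
  have key := kl_layer _ X Y (fun x => f x / a) (fun x => g x / b) (fun x => h x / r) 1 le_rfl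
    (fun x hx => div_nonneg (hf x hx) ha.le) (fun x hx => div_nonneg (hg x hx) hb.le)
    (by obtain ⟨x, hx, h⟩ := hX; exact ⟨x, hx, by simp [h, ha.ne']⟩)
    (by obtain ⟨x, hx, h⟩ := hY; exact ⟨x, hx, by simp [h, hb.ne']⟩)
    (fun x hx => (div_le_one ha).2 (hfs x hx)) (fun x hx => (div_le_one hb).2 (hgs x hx))
    (by
      intro x hx y hy
      have h1 : 0 ≤ f x / a := div_nonneg (hf x hx) ha.le
      have h2 : 0 ≤ g y / b := div_nonneg (hg y hy) hb.le
      refine (sq_le_sq₀ (le_min h1 h2) (div_nonneg (hh0 _) hr0.le)).1 ?_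
      calc min (f x / a) (g y / b) ^ 2 = min (f x / a) (g y / b) * min (f x / a) (g y / b) := sq _
        _ ≤ (f x / a) * (g y / b) := mul_le_mul (min_le_left _ _) (min_le_right _ _) (le_min h1 h2) h1
        _ = f x * g y / (a * b) := by field_simp
        _ ≤ h (x + y) ^ 2 / (a * b) := by
            have := hh x hx y hy
            gcongr
        _ = (h (x + y) / r) ^ 2 := by rw [div_pow, hr2])
  rw [← sum_div, ← sum_div, ← sum_div] at key
  set F := ∑ x ∈ X, f x
  set G := ∑ x ∈ Y, g x
  set H := ∑ z ∈ X + Y, h z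
  have hF : a ≤ F := by
    obtain ⟨x, hx, h⟩ := hX; rw [← h]; exact single_le_sum hf hx
  have hG : b ≤ G := by
    obtain ⟨x, hx, h⟩ := hY; rw [← h]; exact single_le_sum hg hx
  have h1 : 1 ≤ F / a := (one_le_div ha).2 hF
  have h2 : 1 ≤ G / b := (one_le_div hb).2 hG
  have h3 : (F / a + G / b - 1) ^ 2 ≤ (H / r) ^ 2 := by
    apply pow_le_pow_left₀ (by linarith) key
  have h4 : (2 * (F / a) - 1) * (2 * (G / b) - 1) ≤ (F / a + G / b - 1) ^ 2 := by
    nlinarith [sq_nonneg (F / a - G / b)]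
  have h5 : (H / r) ^ 2 = H ^ 2 / (a * b) := by rw [div_pow, hr2]
  have h6 := h4.trans h3
  rw [h5, le_div_iff₀ (mul_pos ha hb)] at h6
  calc _ = (2 * (F / a) - 1) * (2 * (G / b) - 1) * (a * b) := by field_simp
    _ ≤ _ := h6
end

section
open scoped Classical
open Finset Pointwise

/-- shift of a sequence -/
def klShift (f : ℕ → ℚ) : ℕ → ℚ := fun i => Nat.casesOn i 0 f
/-- tail of a sequence -/
def klTail (f : ℕ → ℚ) : ℕ → ℚ := fun i => f (i + 1)
/-- child of a set of sequences -/
noncomputable def klChild (A : Finset (ℕ → ℚ)) (c : ℚ) : Finset (ℕ → ℚ) :=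
  (A.filter (fun f => f 0 = c)).image klTail
/-- recursive functional -/
noncomputable def klM : ℕ → Finset (ℕ → ℚ) → ℕ
  | 0, _ => 1
  | n + 1, A => 2 * ∑ c ∈ A.image (fun f => f 0), klM n (klChild A c) -
      (A.image (fun f => f 0)).sup (fun c => klM n (klChild A c))

theorem klShift_zero (f : ℕ → ℚ) : klShift f 0 = 0 := rfl
theorem klShift_succ (f : ℕ → ℚ) (i : ℕ) : klShift f (i + 1) = f i := rfl
theorem klTail_shift (f : ℕ → ℚ) : klTail (klShift f) = f := rfl
theorem klShift_inj : Function.Injective klShift := fun f g h => by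
  rw [← klTail_shift f, h, klTail_shift]

theorem kl_tail_ext {f g : ℕ → ℚ} (h0 : f 0 = g 0) (h : klTail f = klTail g) : f = g := by
  funext i
  cases i with
  | zero => exact h0
  | succ i => exact congrFun h i

theorem klChild_card (A : Finset (ℕ → ℚ)) (c : ℚ) :
    (klChild A c).card = (A.filter (fun f => f 0 = c)).card := by
  apply card_image_of_injOn
  intro f hf g hg h
  simp only [coe_filter, Set.mem_ofPred_eq] at hf hg
  exact kl_tail_ext (hf.2.trans hg.2.symm) h

theorem mem_klChild {A : Finset (ℕ → ℚ)} {c : ℚ} {f : ℕ → ℚ} :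
    f ∈ klChild A c ↔ ∃ g ∈ A, g 0 = c ∧ klTail g = f := by
  simp [klChild, and_assoc]

theorem klChild_nonempty {A : Finset (ℕ → ℚ)} {c : ℚ} (h : c ∈ A.image (fun f => f 0)) :
    (klChild A c).Nonempty := by
  obtain ⟨f, hf, rfl⟩ := mem_image.1 h
  exact ⟨klTail f, mem_klChild.2 ⟨f, hf, rfl, rfl⟩⟩

theorem klM_cast (n : ℕ) (A : Finset (ℕ → ℚ)) (c : ℚ) (hc : c ∈ A.image (fun f => f 0))
    (hcs : (A.image (fun f => f 0)).sup (fun c => klM n (klChild A c)) = klM n (klChild A c)) :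
    (klM (n + 1) A : ℝ) = 2 * ∑ c ∈ A.image (fun f => f 0), (klM n (klChild A c) : ℝ)
      - klM n (klChild A c) := by
  have h : klM n (klChild A c) ≤ ∑ c ∈ A.image (fun f => f 0), klM n (klChild A c) :=
    single_le_sum (f := fun c => klM n (klChild A c)) (fun _ _ => Nat.zero_le _) hc
  rw [klM, hcs, Nat.cast_sub (by omega)]
  push_cast
  rfl

theorem kl_heavy (n : ℕ) (A : Finset (ℕ → ℚ)) (hA : A.Nonempty) :
    ∃ c ∈ A.image (fun f => f 0),
      (A.image (fun f => f 0)).sup (fun c => klM n (klChild A c)) = klM n (klChild A c) := by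
  obtain ⟨c, hc, h⟩ := exists_mem_eq_sup (A.image (fun f => f 0)) (hA.image _)
    (fun c => klM n (klChild A c))
  exact ⟨c, hc, h⟩

theorem klM_pos (n : ℕ) : ∀ A : Finset (ℕ → ℚ), A.Nonempty → 0 < klM n A := by
  induction n with
  | zero => intro A _; simp [klM]
  | succ n ih =>
    intro A hA
    obtain ⟨c, hc, hcs⟩ := kl_heavy n A hA
    have h : klM n (klChild A c) ≤ ∑ c ∈ A.image (fun f => f 0), klM n (klChild A c) :=
      single_le_sum (f := fun c => klM n (klChild A c)) (fun _ _ => Nat.zero_le _) hc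
    have := ih _ (klChild_nonempty hc)
    rw [klM, hcs]
    omega

theorem klM_mul (n : ℕ) : ∀ A B : Finset (ℕ → ℚ), A.Nonempty → B.Nonempty →
    (klM n A : ℝ) * klM n B ≤ ((A + B).card : ℝ) ^ 2 := by
  induction n with
  | zero =>
    intro A B hA hB
    have : 1 ≤ (A + B).card := card_pos.2 (hA.add hB)
    have : (1 : ℝ) ≤ (A + B).card := by exact_mod_cast this
    simp only [klM]; push_cast; nlinarith
  | succ n ih =>
    intro A B hA hB
    obtain ⟨c, hc, hcs⟩ := kl_heavy n A hA
    obtain ⟨e, he, hes⟩ := kl_heavy n B hB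
    rw [klM_cast n A c hc hcs, klM_cast n B e he hes]
    have hcard : ((A + B).card : ℝ) = ∑ z ∈ A.image (fun f => f 0) + B.image (fun f => f 0),
        (((A + B).filter (fun f => f 0 = z)).card : ℝ) := by
      rw [← Nat.cast_sum]
      congr 1
      apply card_eq_sum_card_fiberwise
      intro f hf
      obtain ⟨a, ha, b, hb, rfl⟩ := mem_add.1 hf
      exact add_mem_add (mem_image_of_mem (fun f : ℕ → ℚ => f 0) ha)
        (mem_image_of_mem (fun f : ℕ → ℚ => f 0) hb)
    rw [hcard]
    apply kl_pl _ _ (fun x => (klM n (klChild A x) : ℝ)) (fun x => (klM n (klChild B x) : ℝ))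
      (fun z => (((A + B).filter (fun f => f 0 = z)).card : ℝ))
    · exact_mod_cast klM_pos n _ (klChild_nonempty hc)
    · exact_mod_cast klM_pos n _ (klChild_nonempty he)
    · intros; positivity
    · intros; positivity
    · exact ⟨c, hc, rfl⟩
    · exact ⟨e, he, rfl⟩
    · intro x hx
      have := le_sup (f := fun c => klM n (klChild A c)) hx
      rw [hcs] at this
      exact_mod_cast this
    · intro x hx
      have := le_sup (f := fun c => klM n (klChild B c)) hx
      rw [hes] at this
      exact_mod_cast this
    · intros; positivity
    · intro x hx y hy
      refine (ih _ _ (klChild_nonempty hx) (klChild_nonempty hy)).trans ?_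
      suffices hs : (klChild A x + klChild B y).card ≤
          ((A + B).filter (fun f => f 0 = x + y)).card by
        have hs' : ((klChild A x + klChild B y).card : ℝ) ≤
          ((A + B).filter (fun f => f 0 = x + y)).card := by exact_mod_cast hs
        exact pow_le_pow_left₀ (by positivity) hs' 2
      refine le_trans (card_le_card ?_) (card_image_le (f := klTail))
      intro f hf
      obtain ⟨a, ha, b, hb, rfl⟩ := mem_add.1 hf
      obtain ⟨a', ha', h1, rfl⟩ := mem_klChild.1 ha
      obtain ⟨b', hb', h2, rfl⟩ := mem_klChild.1 hb
      refine mem_image.2 ⟨a' + b', mem_filter.2 ⟨add_mem_add ha' hb', ?_⟩, rfl⟩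
      simp [h1, h2]

theorem klM_shift (n : ℕ) (A : Finset (ℕ → ℚ)) (hA : A.Nonempty) :
    klM (n + 1) (A.image klShift) = klM n A := by
  have h1 : (A.image klShift).image (fun f => f 0) = {0} := by
    ext x
    simp only [mem_image, exists_exists_and_eq_and, klShift_zero, mem_singleton]
    constructor
    · rintro ⟨_, _, h⟩; exact h.symm
    · rintro rfl; obtain ⟨a, ha⟩ := hA; exact ⟨a, ha, rfl⟩
  have h2 : klChild (A.image klShift) 0 = A := by
    ext f
    rw [mem_klChild]
    constructor
    · rintro ⟨g, hg, _, rfl⟩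
      obtain ⟨a, ha, rfl⟩ := mem_image.1 hg
      exact ha
    · intro hf
      exact ⟨klShift f, mem_image_of_mem _ hf, rfl, rfl⟩
  rw [klM, h1]
  simp [h2]
  omega

theorem kl_count (R : ℕ) (μ : ℝ) (hμ : 1 ≤ μ) (n : ℕ) : ∀ (A : Finset (ℕ → ℚ)) (L : Finset ℕ),
    A.Nonempty →
    (∀ f ∈ A, ∀ g ∈ A, (∀ i < n, f i = g i) → f = g) →
    (∀ f ∈ A, ∀ g ∈ A, ∀ t, (∀ i < t, f i = g i) → f t ≠ g t → t ∈ L) →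
    (∀ f ∈ A, ∀ t, ((A.filter (fun g => ∀ i < t, g i = f i)).image (fun g => g t)).card ≤ R) →
    ∀ D : ℤ, (A.card : ℝ) ≤ klM n A * (2 : ℝ) ^ (-D) + μ ^ D * (1 + R / μ) ^ L.card := by
  have hμ0 : 0 < μ := by linarith
  induction n with
  | zero =>
    intro A L hA hsep _ _ D
    have h1 : A.card ≤ 1 := card_le_one.2 fun f hf g hg => hsep f hf g hg (by simp)
    have h1' : (A.card : ℝ) ≤ 1 := by exact_mod_cast h1
    have h2 : (1 : ℝ) ≤ (1 + R / μ) ^ L.card := one_le_pow₀ (by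
      have : (0 : ℝ) ≤ R / μ := by positivity
      linarith)
    rcases le_total 0 D with hD | hD
    · have h3 : 1 ≤ μ ^ D := one_le_zpow₀ hμ hD
      have h4 : 0 ≤ klM 0 A * (2 : ℝ) ^ (-D) := by positivity
      nlinarith
    · have h3 : (1 : ℝ) ≤ 2 ^ (-D) := one_le_zpow₀ (by norm_num) (by omega)
      have h4 : 0 ≤ μ ^ D * (1 + R / μ) ^ L.card := by positivity
      simp only [klM]; push_cast; linarith
  | succ n ih =>
    intro A L hA hsep hL hR D
    obtain ⟨c, hc, hcs⟩ := kl_heavy n A hA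
    set X := A.image (fun f => f 0) with hX
    set L' := (L.erase 0).image Nat.pred with hL'
    have hih : ∀ x ∈ X, ∀ D : ℤ, ((klChild A x).card : ℝ) ≤
        klM n (klChild A x) * (2 : ℝ) ^ (-D) + μ ^ D * (1 + R / μ) ^ L'.card := by
      intro x hx
      apply ih _ _ (klChild_nonempty hx)
      · intro f hf g hg h
        obtain ⟨f', hf', h1, rfl⟩ := mem_klChild.1 hf
        obtain ⟨g', hg', h2, rfl⟩ := mem_klChild.1 hg
        rw [hsep f' hf' g' hg']
        intro i hi
        cases i with
        | zero => rw [h1, h2]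
        | succ i => exact h i (by omega)
      · intro f hf g hg t h hne
        obtain ⟨f', hf', h1, rfl⟩ := mem_klChild.1 hf
        obtain ⟨g', hg', h2, rfl⟩ := mem_klChild.1 hg
        have := hL f' hf' g' hg' (t + 1) (by
          intro i hi
          cases i with
          | zero => rw [h1, h2]
          | succ i => exact h i (by omega)) hne
        exact mem_image.2 ⟨t + 1, mem_erase.2 ⟨by omega, this⟩, rfl⟩
      · intro f hf t
        obtain ⟨f', hf', h1, rfl⟩ := mem_klChild.1 hf
        refine le_trans (card_le_card ?_) (hR f' hf' (t + 1))
        intro z hz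
        obtain ⟨g, hg, rfl⟩ := mem_image.1 hz
        obtain ⟨hg, hgt⟩ := mem_filter.1 hg
        obtain ⟨g', hg', h2, rfl⟩ := mem_klChild.1 hg
        refine mem_image.2 ⟨g', mem_filter.2 ⟨hg', ?_⟩, rfl⟩
        intro i hi
        cases i with
        | zero => rw [h1, h2]
        | succ i => exact hgt i (by omega)
    have hcard : (A.card : ℝ) = ∑ x ∈ X, ((klChild A x).card : ℝ) := by
      rw [← Nat.cast_sum]
      congr 1
      simp_rw [klChild_card]
      exact card_eq_sum_card_fiberwise fun f hf => mem_image_of_mem _ hf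
    rw [klM_cast n A c hc hcs, hcard]
    rw [← hX, ← add_sum_erase X _ hc, ← add_sum_erase X _ hc]
    have hmain : ∑ x ∈ X.erase c, ((klChild A x).card : ℝ) ≤
        ∑ x ∈ X.erase c, (klM n (klChild A x) * (2 : ℝ) ^ (-(D - 1)) +
          μ ^ (D - 1) * (1 + R / μ) ^ L'.card) :=
      sum_le_sum fun x hx => hih x (mem_of_mem_erase hx) (D - 1)
    rw [sum_add_distrib, ← sum_mul, sum_const, nsmul_eq_mul] at hmain
    have hcc := hih c hc D
    have hz : (2 : ℝ) ^ (-(D - 1)) = 2 * 2 ^ (-D) := by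
      rw [show -(D - 1) = 1 + -D by ring, zpow_add₀ (by norm_num), zpow_one]
    have hz2 : μ ^ (D - 1) = μ ^ D / μ := by rw [zpow_sub_one₀ hμ0.ne']; rfl
    rw [hz, hz2] at hmain
    have hρ : (1 : ℝ) ≤ 1 + R / μ := by
      have : (0 : ℝ) ≤ R / μ := by positivity
      linarith
    have hμD : 0 < μ ^ D := by positivity
    have hfin : μ ^ D * (1 + R / μ) ^ L'.card +
        (X.erase c).card * (μ ^ D / μ * (1 + R / μ) ^ L'.card) ≤ μ ^ D * (1 + R / μ) ^ L.card := by
      by_cases h0 : 0 ∈ L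
      · have hXR : (X.erase c).card ≤ R := by
          refine (card_le_card (erase_subset _ _)).trans ?_
          obtain ⟨f, hf⟩ := hA
          simpa using hR f hf 0
        have hLc : L'.card + 1 ≤ L.card := by
          have h1 : L'.card ≤ (L.erase 0).card := card_image_le
          have h2 := card_erase_add_one h0
          omega
        have hXR' : ((X.erase c).card : ℝ) ≤ R := by exact_mod_cast hXR
        calc _ ≤ μ ^ D * (1 + R / μ) ^ L'.card + R * (μ ^ D / μ * (1 + R / μ) ^ L'.card) := by
              gcongr
          _ = μ ^ D * (1 + R / μ) ^ (L'.card + 1) := by rw [pow_succ]; field_simp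
          _ ≤ _ := by gcongr
      · have hXe : X.erase c = ∅ := by
          rw [eq_empty_iff_forall_notMem]
          intro x hx
          obtain ⟨hne, hx⟩ := mem_erase.1 hx
          obtain ⟨f, hf, rfl⟩ := mem_image.1 hx
          obtain ⟨g, hg, rfl⟩ := mem_image.1 hc
          exact h0 (hL f hf g hg 0 (by simp) hne)
        have hLc : L'.card ≤ L.card := card_image_le.trans (card_le_card (erase_subset _ _))
        rw [hXe]
        simp only [card_empty, Nat.cast_zero, zero_mul, add_zero]
        gcongr
    linarith
end

section
open scoped Classical
open Finset Pointwise

theorem kl_branch (R t : ℕ) (B : Finset (ℕ → ℚ))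
    (hR : ∀ f ∈ B, R ≤ ((B.filter (fun g => ∀ i < t, g i = f i)).image (fun g => g t)).card) :
    R * B.card ≤ (B + B.image klShift).card := by
  rcases B.eq_empty_or_nonempty with rfl | hB
  · simp
  -- prefixes
  let π : ℕ → (ℕ → ℚ) → (ℕ → ℚ) := fun s f i => if i < s then f i else 0
  have hπ : ∀ s f g, π s f = π s g ↔ ∀ i < s, f i = g i := by
    intro s f g
    constructor
    · intro h i hi
      have := congrFun h i
      simpa [π, hi] using this
    · intro h
      funext i
      by_cases hi : i < s
      · simp [π, hi, h i hi]
      · simp [π, hi]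
  set P := B.image (π t) with hP
  set Q := B.image (π (t + 1)) with hQ
  have hππ : ∀ f, π t (π (t + 1) f) = π t f := by
    intro f
    rw [hπ]
    intro i hi
    simp [π, show i < t + 1 by omega]
  have hPQ : R * P.card ≤ Q.card := by
    apply mul_card_image_le_card_of_maps_to (f := π t)
    · intro q hq
      obtain ⟨f, hf, rfl⟩ := mem_image.1 hq
      rw [hππ]
      exact mem_image_of_mem _ hf
    · intro p hp
      obtain ⟨f, hf, rfl⟩ := mem_image.1 hp
      refine (hR f hf).trans ?_
      refine le_trans (card_le_card ?_) (card_image_le (f := fun q : ℕ → ℚ => q t))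
      intro z hz
      obtain ⟨g, hg, rfl⟩ := mem_image.1 hz
      obtain ⟨hg, hgf⟩ := mem_filter.1 hg
      refine mem_image.2 ⟨π (t + 1) g, mem_filter.2 ⟨mem_image_of_mem _ hg, ?_⟩, by simp [π]⟩
      rw [hππ, hπ]
      exact hgf
  obtain ⟨y, hy, hymax⟩ := exists_max_image P (fun y => (B.filter (fun f => π t f = y)).card)
    (hB.image _)
  set Y := B.filter (fun f => π t f = y) with hY
  have hBY : B.card ≤ P.card * Y.card := by
    rw [card_eq_sum_card_fiberwise (f := π t) (t := P) (fun f hf => mem_image_of_mem _ hf)]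
    calc _ ≤ ∑ _b ∈ P, Y.card := sum_le_sum hymax
      _ = _ := by simp
  have hQY : Q.card * Y.card ≤ (B + B.image klShift).card := by
    have hch : ∀ q ∈ Q, ∃ f ∈ B, π (t + 1) f = q := fun q hq => mem_image.1 hq
    choose! r hrB hr using hch
    rw [← card_product]
    apply card_le_card_of_injOn (fun p => r p.1 + klShift p.2)
    · rintro ⟨q, f⟩ hqf
      obtain ⟨hq, hf⟩ := mem_product.1 hqf
      exact add_mem_add (hrB q hq) (mem_image_of_mem _ (mem_filter.1 hf).1)
    · rintro ⟨q, f⟩ hqf ⟨q', f'⟩ hqf' h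
      obtain ⟨hq, hf⟩ := mem_product.1 hqf
      obtain ⟨hq', hf'⟩ := mem_product.1 hqf'
      dsimp only at hq hf hq' hf' h
      have hff : ∀ i < t, f i = f' i := (hπ _ _ _).1
        ((mem_filter.1 hf).2.trans (mem_filter.1 hf').2.symm)
      have hqq : q = q' := by
        rw [← hr q hq, ← hr q' hq', hπ]
        intro i hi
        have := congrFun h i
        cases i with
        | zero => simpa [klShift_zero] using this
        | succ i =>
          simp only [Pi.add_apply, klShift_succ, hff i (by omega)] at this
          linarith
      subst hqq
      have := klShift_inj (add_left_cancel h)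
      rw [this]
  calc R * B.card ≤ R * (P.card * Y.card) := by gcongr
    _ = (R * P.card) * Y.card := by ring
    _ ≤ Q.card * Y.card := by gcongr
    _ ≤ _ := hQY

theorem kl_sum_mem (A : Finset (ℕ → ℚ)) (u : ℕ → ℕ → ℚ) (I : Finset ℕ) (hu : ∀ t ∈ I, u t ∈ A) :
    ∑ t ∈ I, u t ∈ I.card • A := by
  induction I using Finset.induction_on with
  | empty => simp
  | insert a s ha ih =>
    rw [sum_insert ha, card_insert_of_notMem ha, succ_nsmul']
    exact add_mem_add (hu a (mem_insert_self _ _)) (ih fun t ht => hu t (mem_insert_of_mem ht))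

theorem kl_levels (A : Finset (ℕ → ℚ)) (L : Finset ℕ) (m : ℕ)
    (hL : ∀ t ∈ L, ∃ f ∈ A, ∃ g ∈ A, (∀ i < t, f i = g i) ∧ f t ≠ g t) :
    L.card.choose m ≤ (m • A - m • A).card := by
  choose! u hu w hw huw hne using hL
  rw [← card_powersetCard]
  apply card_le_card_of_injOn (fun I => ∑ t ∈ I, u t - ∑ t ∈ I, w t)
  · intro I hI
    obtain ⟨hIL, hIm⟩ := mem_powersetCard.1 hI
    rw [← hIm]
    exact sub_mem_sub (kl_sum_mem _ _ _ fun t ht => hu t (hIL ht))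
      (kl_sum_mem _ _ _ fun t ht => hw t (hIL ht))
  · intro I hI J hJ h
    have hIL := (mem_powersetCard.1 hI).1
    have hJL := (mem_powersetCard.1 hJ).1
    dsimp only at h
    rw [← sum_sub_distrib, ← sum_sub_distrib] at h
    by_contra hIJ
    have hsd : (symmDiff I J).Nonempty := by
      rw [nonempty_iff_ne_empty]
      intro h0
      exact hIJ (symmDiff_eq_bot.1 h0)
    obtain ⟨t, ht, hmin⟩ := exists_min_image _ id hsd
    have hval : ∀ K : Finset ℕ, K ⊆ L → (∑ s ∈ K, (u s - w s)) t =
        ∑ s ∈ K.filter (fun s => s < t), (u s - w s) t + if t ∈ K then (u t - w t) t else 0 := by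
      intro K hK
      rw [Finset.sum_apply, ← sum_filter_add_sum_filter_not K (fun s => s < t)]
      congr 1
      rw [← sum_ite_eq' K t (fun s => (u s - w s) t), sum_filter]
      apply sum_congr rfl
      intro s hs
      by_cases h1 : s < t
      · simp [h1, h1.ne]
      · by_cases h2 : s = t
        · simp [h2]
        · have : t < s := by omega
          simp [h1, h2, huw s (hK hs) t this]
    have hfil : I.filter (fun s => s < t) = J.filter (fun s => s < t) := by
      ext s
      simp only [mem_filter]
      constructor
      · rintro ⟨h1, h2⟩
        refine ⟨?_, h2⟩
        by_contra h3
        have := hmin s (mem_symmDiff.2 (Or.inl ⟨h1, h3⟩))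
        simp only [id] at this; omega
      · rintro ⟨h1, h2⟩
        refine ⟨?_, h2⟩
        by_contra h3
        have := hmin s (mem_symmDiff.2 (Or.inr ⟨h1, h3⟩))
        simp only [id] at this; omega
    have h1 := hval I hIL
    have h2 := hval J hJL
    rw [h, h2, hfil] at h1
    rcases mem_symmDiff.1 ht with ⟨h3, h4⟩ | ⟨h3, h4⟩
    · simp only [h3, h4, if_true, if_false] at h1
      have := hne t (hIL h3)
      simp only [Pi.sub_apply] at h1
      apply this; linarith
    · simp only [h3, h4, if_true, if_false] at h1
      have := hne t (hJL h3)
      simp only [Pi.sub_apply] at h1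
      apply this; linarith

theorem kl_dim (A : Finset (ℕ → ℚ)) (hA : A.Nonempty) (L : Finset ℕ) (m K : ℕ)
    (hL : ∀ t ∈ L, ∃ f ∈ A, ∃ g ∈ A, (∀ i < t, f i = g i) ∧ f t ≠ g t)
    (hm : 0 < m) (hAm : A.card ≤ 3 ^ m) (hK : 0 < K)
    (hAK : (A + A.image klShift).card ≤ K * A.card) :
    L.card ≤ 4 * m * K ^ 2 := by
  have h1 := kl_levels A L m hL
  have h2 := pluennecke_ruzsa_inequality_nsmul_sub_nsmul_add (hA.image klShift) A m m
  rw [card_image_of_injective _ klShift_inj, add_comm (A.image klShift) A] at h2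
  have hA0 : 0 < A.card := card_pos.2 hA
  have h3 : ((A + A.image klShift).card / A.card : ℚ≥0) ≤ K := by
    rw [div_le_iff₀ (by exact_mod_cast hA0)]
    exact_mod_cast hAK
  have h4 : ((m • A - m • A).card : ℚ≥0) ≤ (K : ℚ≥0) ^ (m + m) * 3 ^ m := by
    refine h2.trans ?_
    have : (A.card : ℚ≥0) ≤ 3 ^ m := by exact_mod_cast hAm
    gcongr
  have h4' : (m • A - m • A).card ≤ K ^ (m + m) * 3 ^ m := by exact_mod_cast h4
  have h5 : L.card.choose m ≤ (3 * K ^ 2) ^ m := by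
    refine (h1.trans h4').trans (le_of_eq ?_)
    rw [mul_pow, ← pow_mul, mul_comm, two_mul]
  have h6 : ((L.card + 1 - m) : ℕ) ^ m ≤ m.factorial * L.card.choose m := by
    have := Nat.pow_le_choose (α := ℝ) m L.card
    rw [div_le_iff₀ (by positivity), mul_comm] at this
    exact_mod_cast this
  have h7 : (L.card + 1 - m) ^ m ≤ (m * (3 * K ^ 2)) ^ m := by
    rw [mul_pow]
    exact h6.trans (Nat.mul_le_mul (Nat.factorial_le_pow m) h5)
  have h8 := (Nat.pow_le_pow_iff_left hm.ne').1 h7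
  have h9 : m ≤ m * K ^ 2 := Nat.le_mul_of_pos_right _ (by positivity)
  have : 4 * m * K ^ 2 = m * (3 * K ^ 2) + m * K ^ 2 := by ring
  omega
end

section
open scoped Classical
open Finset Pointwise

theorem kl_seq (A : Finset (ℕ → ℚ)) (hA : A.Nonempty) (n : ℕ)
    (hn : ∀ f ∈ A, ∀ i, n ≤ i → f i = 0) (m K D : ℕ) (hm : 0 < m) (hAm : A.card ≤ 3 ^ m)
    (hK : 0 < K) (hAK : (A + A.image klShift).card ≤ K * A.card) (hD : 4 * K ≤ 2 ^ D) :
    (A.card : ℝ) ≤ 12 * ((4 * m * K ^ 2 : ℕ) * (2 * (4 * m * K ^ 2) * K : ℕ) : ℝ) ^ D := by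
  set d := 4 * m * K ^ 2 with hd
  set R := 2 * d * K with hRd
  have hd0 : 0 < d := by positivity
  have hR0 : 0 < R := by positivity
  have hA0 : 0 < A.card := card_pos.2 hA
  set L := (range n).filter
    (fun t => ∃ f ∈ A, ∃ g ∈ A, (∀ i < t, f i = g i) ∧ f t ≠ g t) with hL
  have hLd : L.card ≤ d := kl_dim A hA L m K (fun t ht => (mem_filter.1 ht).2) hm hAm hK hAK
  have hLA : ∀ f ∈ A, ∀ g ∈ A, ∀ t, (∀ i < t, f i = g i) → f t ≠ g t → t ∈ L := by
    intro f hf g hg t h hne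
    refine mem_filter.2 ⟨mem_range.2 ?_, f, hf, g, hg, h, hne⟩
    by_contra hc
    exact hne (by rw [hn f hf t (by omega), hn g hg t (by omega)])
  let cnt : ℕ → (ℕ → ℚ) → ℕ := fun t f =>
    ((A.filter (fun g => ∀ i < t, g i = f i)).image (fun g => g t)).card
  let B : ℕ → Finset (ℕ → ℚ) := fun t => A.filter (fun f => R < cnt t f)
  have hB : ∀ t, R * (B t).card ≤ K * A.card := by
    intro t
    refine le_trans (kl_branch R t (B t) ?_) (le_trans (card_le_card ?_) hAK)
    · intro f hf
      have h1 := (mem_filter.1 hf).2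
      have h2 : (B t).filter (fun g => ∀ i < t, g i = f i) =
          A.filter (fun g => ∀ i < t, g i = f i) := by
        ext g
        simp only [B, mem_filter]
        constructor
        · rintro ⟨⟨h1, _⟩, h3⟩; exact ⟨h1, h3⟩
        · rintro ⟨h3, h4⟩
          refine ⟨⟨h3, ?_⟩, h4⟩
          have : cnt t g = cnt t f := by
            simp only [cnt]
            congr 2
            apply filter_congr
            intro x _
            constructor
            · intro h i hi; rw [h i hi, h4 i hi]
            · intro h i hi; rw [h i hi, h4 i hi]
          rw [this]; exact h1
      rw [h2]
      exact h1.le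
    · have hs : B t ⊆ A := filter_subset _ _
      exact add_subset_add hs (image_subset_image hs)
  set U := L.biUnion B with hU
  have hUA : U ⊆ A := biUnion_subset.2 fun t _ => filter_subset _ _
  have hUc : 2 * U.card ≤ A.card := by
    have h1 : U.card ≤ ∑ t ∈ L, (B t).card := card_biUnion_le
    have h2 : R * ∑ t ∈ L, (B t).card ≤ L.card * (K * A.card) := by
      rw [mul_sum]
      exact (sum_le_sum fun t _ => hB t).trans (by simp)
    have h3 : R * (2 * U.card) ≤ R * A.card := by
      calc R * (2 * U.card) = 2 * (R * U.card) := by ring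
        _ ≤ 2 * (R * ∑ t ∈ L, (B t).card) := by gcongr
        _ ≤ 2 * (L.card * (K * A.card)) := by gcongr
        _ ≤ 2 * (d * (K * A.card)) := by gcongr
        _ = R * A.card := by rw [hRd]; ring
    exact Nat.le_of_mul_le_mul_left h3 hR0
  set A' := A \ U with hA'
  have hA'A : A' ⊆ A := sdiff_subset
  have hA'c : A.card ≤ 2 * A'.card := by
    have : A'.card + U.card = A.card := by
      convert card_sdiff_add_card_eq_card hUA
    omega
  have hA'n : A'.Nonempty := card_pos.1 (by omega)
  have hbr : ∀ f ∈ A', ∀ t,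
      ((A'.filter (fun g => ∀ i < t, g i = f i)).image (fun g => g t)).card ≤ R := by
    intro f hf t
    have h1 : ((A'.filter (fun g => ∀ i < t, g i = f i)).image (fun g => g t)).card ≤ cnt t f :=
      card_le_card (image_subset_image (filter_subset_filter _ hA'A))
    refine h1.trans ?_
    by_contra hc
    push Not at hc
    have hfA := hA'A hf
    have htL : t ∈ L := by
      have : 1 < cnt t f := by omega
      obtain ⟨a, ha, b, hb, hab⟩ := one_lt_card.1 this
      obtain ⟨g, hg, rfl⟩ := mem_image.1 ha
      obtain ⟨g', hg', rfl⟩ := mem_image.1 hb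
      obtain ⟨hg, hgf⟩ := mem_filter.1 hg
      obtain ⟨hg', hgf'⟩ := mem_filter.1 hg'
      exact hLA g hg g' hg' t (fun i hi => by rw [hgf i hi, hgf' i hi]) hab
    exact (mem_sdiff.1 hf).2 (mem_biUnion.2 ⟨t, htL, mem_filter.2 ⟨hfA, hc⟩⟩)
  set μ : ℝ := (d : ℝ) * (R : ℝ) with hμ
  have hdR : (1 : ℝ) ≤ d := by exact_mod_cast hd0
  have hRR : (1 : ℝ) ≤ R := by exact_mod_cast hR0
  have hμ1 : 1 ≤ μ := by nlinarith
  have hct : ∀ k, n ≤ k → (A'.card : ℝ) ≤ klM k A' * (2 : ℝ) ^ (-(D : ℤ)) +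
      μ ^ (D : ℤ) * (1 + R / μ) ^ L.card := by
    intro k hk
    apply kl_count R μ hμ1 k A' L hA'n _ _ hbr
    · intro f hf g hg h
      funext i
      by_cases hi : i < k
      · exact h i hi
      · rw [hn f (hA'A hf) i (by omega), hn g (hA'A hg) i (by omega)]
    · intro f hf g hg
      exact hLA f (hA'A hf) g (hA'A hg)
  have hMM := klM_mul (n + 1) A' (A'.image klShift) hA'n (hA'n.image _)
  rw [klM_shift n A' hA'n] at hMM
  have hS : ((A' + A'.image klShift).card : ℝ) ≤ K * A.card := by
    have : (A' + A'.image klShift).card ≤ K * A.card :=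
      (card_le_card (add_subset_add hA'A (image_subset_image hA'A))).trans hAK
    exact_mod_cast this
  have hex : ∃ k, n ≤ k ∧ (klM k A' : ℝ) ≤ K * A.card := by
    by_contra hc
    push Not at hc
    have h1 := hc n le_rfl
    have h2 := hc (n + 1) (by omega)
    have h3 : (0 : ℝ) ≤ (A' + A'.image klShift).card := by positivity
    nlinarith
  obtain ⟨k, hk, hkM⟩ := hex
  have h1 := hct k hk
  have h2 : (klM k A' : ℝ) * (2 : ℝ) ^ (-(D : ℤ)) ≤ A.card / 4 := by
    rw [zpow_neg, zpow_natCast, ← div_eq_mul_inv, div_le_iff₀ (by positivity)]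
    have : (4 * K : ℝ) ≤ 2 ^ D := by exact_mod_cast hD
    have hA0' : (0 : ℝ) ≤ A.card := by positivity
    nlinarith
  have h3 : (1 + R / μ) ^ L.card ≤ (3 : ℝ) := by
    have e1 : (R : ℝ) / μ = 1 / d := by rw [hμ]; field_simp
    rw [e1]
    have e2 : (1 : ℝ) ≤ 1 + 1 / d := by
      have : (0 : ℝ) ≤ 1 / d := by positivity
      linarith
    calc (1 + 1 / (d : ℝ)) ^ L.card ≤ (1 + 1 / (d : ℝ)) ^ d := pow_le_pow_right₀ e2 hLd
      _ ≤ (Real.exp (1 / d)) ^ d := by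
        gcongr
        have := Real.add_one_le_exp (1 / (d : ℝ))
        linarith
      _ = Real.exp 1 := by rw [← Real.exp_nat_mul]; congr 1; field_simp
      _ ≤ 3 := Real.exp_one_lt_three.le
  rw [zpow_natCast] at h1
  have h4 : μ ^ D * (1 + R / μ) ^ L.card ≤ μ ^ D * 3 := by gcongr
  have h5 : (A.card : ℝ) ≤ 2 * A'.card := by exact_mod_cast hA'c
  linarith

theorem kl_card_image_le {β γ δ : Type*} (s : Finset β) (f : β → γ) (g : β → δ)
    (h : ∀ x ∈ s, ∀ y ∈ s, g x = g y → f x = f y) : (s.image f).card ≤ (s.image g).card := by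
  rcases s.eq_empty_or_nonempty with rfl | ⟨x₀, hx₀⟩
  · simp
  have : Nonempty β := ⟨x₀⟩
  have hch : ∀ z ∈ s.image g, ∃ x ∈ s, g x = z := fun z hz => mem_image.1 hz
  choose! r hr hr' using hch
  apply card_le_card_of_surjOn (fun z => f (r z))
  intro z hz
  obtain ⟨x, hx, rfl⟩ := mem_image.1 hz
  have hgx := mem_image_of_mem g hx
  exact ⟨g x, hgx, h _ (hr _ hgx) _ hx (hr' _ hgx)⟩

theorem kl_poly {k E : Type*} [Field k] [Field E] [Algebra k E] [CharZero E] (A : Finset E)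
    (α : E) (hα : Transcendental k α) : ∃ p : E → Polynomial k, Set.InjOn p A ∧
      ∀ x ∈ A, ∀ y ∈ A, ∀ x' ∈ A, ∀ y' ∈ A, x + α * y = x' + α * y' →
        p x + Polynomial.X * p y = p x' + Polynomial.X * p y' := by
  let F := IntermediateField.adjoin k {α}
  let αF : F := ⟨α, IntermediateField.mem_adjoin_simple_self k α⟩
  have : CharZero F := RingHom.charZero (algebraMap F E)
  obtain ⟨Λ, hΛ⟩ := Module.exists_dual_forall_apply_ne_zero (K := F) (M := E)
    (ι := {p : A × A // p.1 ≠ p.2}) (fun p => (p.1.1 : E) - p.1.2)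
    (fun p => sub_ne_zero.2 fun h => p.2 (Subtype.ext h))
  let σ := (RatFunc.algEquivOfTranscendental α hα).symm
  have hσ : σ αF = RatFunc.X := by
    rw [AlgEquiv.symm_apply_eq]
    apply Subtype.ext
    simp [αF]
  let r : E → RatFunc k := fun a => σ (Λ a)
  have hr : ∀ a b, r (a + α * b) = r a + RatFunc.X * r b := by
    intro a b
    have : a + α * b = a + αF • b := rfl
    simp only [r]
    rw [this, map_add, map_smul, map_add, smul_eq_mul, map_mul, hσ]
  have hrinj : ∀ a ∈ A, ∀ b ∈ A, r a = r b → a = b := by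
    intro a ha b hb h
    by_contra hne
    have h1 := hΛ ⟨(⟨a, ha⟩, ⟨b, hb⟩), fun h => hne (congrArg Subtype.val h)⟩
    apply h1
    rw [map_sub, σ.injective h, sub_self]
  obtain ⟨b, hb⟩ := IsLocalization.exist_integer_multiples (nonZeroDivisors (Polynomial k)) A r
  have hb0 : algebraMap (Polynomial k) (RatFunc k) b ≠ 0 := by
    intro h
    have := (IsFractionRing.injective (Polynomial k) (RatFunc k)) (h.trans (map_zero _).symm)
    exact nonZeroDivisors.ne_zero b.2 this
  choose! p hp using hb
  have hp' : ∀ a ∈ A, algebraMap (Polynomial k) (RatFunc k) (p a) =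
      algebraMap (Polynomial k) (RatFunc k) b * r a := by
    intro a ha
    rw [hp a ha, Algebra.smul_def]
  refine ⟨p, ?_, ?_⟩
  · intro x hx y hy h1
    apply hrinj x hx y hy
    have h2 := hp' x hx
    rw [h1, hp' y hy] at h2
    exact (mul_left_cancel₀ hb0 h2).symm
  · intro x hx y hy x' hx' y' hy' h
    have h1 : r x + RatFunc.X * r y = r x' + RatFunc.X * r y' := by
      rw [← hr, ← hr, h]
    apply IsFractionRing.injective (Polynomial k) (RatFunc k)
    rw [map_add, map_add, map_mul, map_mul, hp' x hx, hp' y hy, hp' x' hx', hp' y' hy',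
      RatFunc.algebraMap_X]
    linear_combination (algebraMap (Polynomial k) (RatFunc k) b) * h1

theorem kl_red (A : Finset ℝ) (α : ℝ) (hα : Transcendental ℚ α) :
    ∃ (A' : Finset (ℕ → ℚ)) (n : ℕ), A'.card = A.card ∧
      (∀ f ∈ A', ∀ i, n ≤ i → f i = 0) ∧
      (A' + A'.image klShift).card ≤
        ((A ×ˢ A).image (fun p => p.1 + α * p.2)).card := by
  obtain ⟨p, hpi, hpe⟩ := kl_poly A α hα
  let φ : ℝ → ℕ → ℚ := fun a => (p a).coeff
  have hφ : Set.InjOn φ A := fun x hx y hy h => hpi hx hy (Polynomial.coeff_injective h)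
  have hcX : ∀ q : Polynomial ℚ, klShift q.coeff = (Polynomial.X * q).coeff := by
    intro q
    funext i
    cases i with
    | zero => simp [klShift_zero]
    | succ i => simp [klShift_succ]
  refine ⟨A.image φ, (A.sup fun a => (p a).natDegree) + 1, card_image_of_injOn hφ, ?_, ?_⟩
  · intro f hf i hi
    obtain ⟨a, ha, rfl⟩ := mem_image.1 hf
    apply Polynomial.coeff_eq_zero_of_natDegree_lt
    have := le_sup (f := fun a => (p a).natDegree) ha
    omega
  · have e : A.image φ + (A.image φ).image klShift =
        (A ×ˢ A).image (fun q => φ q.1 + klShift (φ q.2)) := by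
      ext f
      simp only [mem_add, mem_image, mem_product, Prod.exists]
      constructor
      · rintro ⟨_, ⟨a, ha, rfl⟩, _, ⟨_, ⟨c, hc, rfl⟩, rfl⟩, rfl⟩
        exact ⟨a, c, ⟨ha, hc⟩, rfl⟩
      · rintro ⟨a, c, ⟨ha, hc⟩, rfl⟩
        exact ⟨_, ⟨a, ha, rfl⟩, _, ⟨_, ⟨c, hc, rfl⟩, rfl⟩, rfl⟩
    rw [e]
    apply kl_card_image_le
    rintro ⟨x, y⟩ hxy ⟨x', y'⟩ hxy' h
    obtain ⟨hx, hy⟩ := mem_product.1 hxy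
    obtain ⟨hx', hy'⟩ := mem_product.1 hxy'
    dsimp only at hx hy hx' hy' h ⊢
    have h2 := hpe x hx y hy x' hx' y' hy' h
    have h3 : ∀ u v : ℝ, φ u + klShift (φ v) = (p u + Polynomial.X * p v).coeff := by
      intro u v
      simp only [φ]
      rw [hcX]
      funext i
      simp
    rw [h3, h3, h2]
end

section
open Pointwise Asymptotics

theorem kl_eventually : ∃ m₀ : ℕ, 1 ≤ m₀ ∧ ∀ m : ℕ, m₀ ≤ m →
    Real.log 12 + (4 + 3 * Real.log m) * (Real.log 32 + 12 * Real.log m) < m - 1 := by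
  have h := (isLittleO_iff.1 (Real.isLittleO_pow_log_id_atTop (n := 2))
    (show (0 : ℝ) < 1 / 1000 by norm_num))
  have h' := tendsto_natCast_atTop_atTop (R := ℝ) |>.eventually h
  have h2 := (Real.tendsto_log_atTop.comp (tendsto_natCast_atTop_atTop (R := ℝ))).eventually_ge_atTop 1
  obtain ⟨m₀, hm₀⟩ := Filter.eventually_atTop.1 (h'.and (h2.and (Filter.eventually_ge_atTop 10)))
  refine ⟨max m₀ 1, le_max_right _ _, fun m hm => ?_⟩
  obtain ⟨h1, h3, h4⟩ := hm₀ m ((le_max_left _ _).trans hm)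
  simp only [Function.comp, id, Real.norm_eq_abs, abs_pow, sq_abs, Nat.abs_cast] at h1 h3
  have h5 : (10 : ℝ) ≤ m := by exact_mod_cast h4
  have hl2 := Real.log_two_lt_d9
  have e32 : Real.log 32 = 5 * Real.log 2 := by
    rw [show (32 : ℝ) = 2 ^ 5 by norm_num, Real.log_pow]; norm_num
  have e12 : Real.log 12 ≤ 4 * Real.log 2 := by
    rw [show 4 * Real.log 2 = Real.log (2 ^ 4) by rw [Real.log_pow]; norm_num]
    exact Real.log_le_log (by norm_num) (by norm_num)
  rw [e32]
  set l := Real.log m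
  have : (4 + 3 * l) * (5 * Real.log 2 + 12 * l) ≤ (7 * l) * (16 * l) := by
    apply mul_le_mul <;> first | linarith | nlinarith [Real.log_two_gt_d9]
  nlinarith

theorem kl_main (m₀ : ℕ) (hm₁ : 1 ≤ m₀) (hm₀ : ∀ m : ℕ, m₀ ≤ m →
    Real.log 12 + (4 + 3 * Real.log m) * (Real.log 32 + 12 * Real.log m) < m - 1)
    (A : Finset ℝ) (α : ℝ) (hA : 16 ≤ A.card) (hα : Transcendental ℚ α)
    (hm : m₀ ≤ ⌈Real.log A.card⌉₊) :
    (Real.log A.card) ^ 2 * A.card ≤ ((Finset.image₂ (fun a b => a + α * b) A A).card : ℝ) := by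
  classical
  set l := Real.log A.card with hl
  set m := ⌈l⌉₊ with hmdef
  have hA0 : (0 : ℝ) < A.card := by
    have : 0 < A.card := by omega
    exact_mod_cast this
  have hl0 : 0 ≤ l := Real.log_nonneg (by
    have : 1 ≤ A.card := by omega
    exact_mod_cast this)
  have hlm : l ≤ m := Nat.le_ceil l
  have hml : (m : ℝ) - 1 < l := by
    have := Nat.ceil_lt_add_one hl0
    rw [← hmdef] at this
    linarith
  obtain ⟨A', n, hc, hn, hS⟩ := kl_red A α hα
  have hS' : (A' + A'.image klShift).card ≤ (Finset.image₂ (fun a b => a + α * b) A A).card := by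
    refine hS.trans (le_of_eq ?_)
    rfl
  have hm0 : 0 < m := by omega
  have hmR : (1 : ℝ) ≤ m := by exact_mod_cast hm0
  by_contra hcon
  push Not at hcon
  have hAK : (A' + A'.image klShift).card ≤ m ^ 2 * A'.card := by
    have : ((A' + A'.image klShift).card : ℝ) ≤ (m : ℝ) ^ 2 * A.card := by
      have h1 : ((A' + A'.image klShift).card : ℝ) ≤
        (Finset.image₂ (fun a b => a + α * b) A A).card := by exact_mod_cast hS'
      have h2 : l ^ 2 * A.card ≤ (m : ℝ) ^ 2 * A.card := by gcongr
      linarith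
    rw [hc]
    exact_mod_cast this
  have hexp : (A.card : ℝ) = Real.exp l := (Real.exp_log hA0).symm
  have hA3 : A'.card ≤ 3 ^ m := by
    rw [hc]
    have : (A.card : ℝ) ≤ 3 ^ m := by
      rw [hexp]
      calc Real.exp l ≤ Real.exp m := Real.exp_le_exp.2 hlm
        _ = Real.exp 1 ^ m := by rw [← Real.exp_nat_mul]; simp
        _ ≤ 3 ^ m := by gcongr; exact Real.exp_one_lt_three.le
    exact_mod_cast this
  set k := Nat.clog 2 m with hk
  have hkm : m ≤ 2 ^ k := Nat.le_pow_clog (by norm_num) m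
  have hkl : (k : ℝ) * Real.log 2 ≤ Real.log m + Real.log 2 := by
    have h1 : 2 ^ k ≤ 2 * m := by
      rcases Nat.lt_or_ge 1 m with h | h
      · have h2 := Nat.pow_pred_clog_lt_self (b := 2) (by norm_num) h
        rw [← hk] at h2
        have h3 : 0 < k := Nat.clog_pos (by norm_num) h
        obtain ⟨j, hj⟩ : ∃ j, k = j + 1 := ⟨k - 1, by omega⟩
        rw [hj] at h2 ⊢
        simp only [Nat.pred_eq_sub_one, Nat.add_sub_cancel] at h2
        rw [pow_succ]; omega
      · have : m = 1 := by omega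
        rw [hk, this]; simp
    have h1' : (2 : ℝ) ^ k ≤ 2 * m := by exact_mod_cast h1
    have h2 := Real.log_le_log (by positivity) h1'
    rw [Real.log_pow, Real.log_mul (by norm_num) (by positivity)] at h2
    linarith
  have hD : 4 * m ^ 2 ≤ 2 ^ (2 * k + 2) := by
    rw [pow_add, mul_comm 2 k, pow_mul]
    have := Nat.pow_le_pow_left hkm 2
    omega
  have hA'n : A'.Nonempty := Finset.card_pos.1 (by omega)
  have key := kl_seq A' hA'n n hn m (m ^ 2) (2 * k + 2) hm0 hA3 (by positivity) hAK hD
  rw [hc] at key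
  have e : ((4 * m * (m ^ 2) ^ 2 : ℕ) * (2 * (4 * m * (m ^ 2) ^ 2) * m ^ 2 : ℕ) : ℝ) =
      32 * (m : ℝ) ^ 12 := by push_cast; ring
  rw [e] at key
  have key2 := Real.log_le_log hA0 key
  rw [Real.log_mul (by norm_num) (by positivity), Real.log_pow,
    Real.log_mul (by norm_num) (by positivity), Real.log_pow, ← hl] at key2
  push_cast at key2
  have hfin := hm₀ m hm
  have hlog : 0 ≤ Real.log m := Real.log_nonneg hmR
  have hk2 : 2 * (k : ℝ) + 2 ≤ 4 + 3 * Real.log m := by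
    have := Real.log_two_gt_d9
    have h2 : ((k : ℝ) - 1) * Real.log 2 ≤ Real.log m := by linarith
    by_contra hc
    push Not at hc
    have h3 : 1.5 * Real.log m < (k : ℝ) - 1 := by linarith
    nlinarith
  have hpos : 0 ≤ Real.log 32 + 12 * Real.log m := by
    have : 0 ≤ Real.log 32 := Real.log_nonneg (by norm_num)
    linarith
  have := mul_le_mul_of_nonneg_right hk2 hpos
  linarith

end

/-- **Improved Konyagin–Łaba theorem.** There is an absolute constant `c > 0` such that for any
finite `A ⊆ ℝ` with `|A| ≥ 16` and any transcendental `α ∈ ℝ` one has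
`|A + α·A| ≥ c |A| (log |A|)^{4/3} / (log log |A|)^{8/3}`. -/
theorem konyagin_laba_improved :
    ∃ c : ℝ, 0 < c ∧
      ∀ (A : Finset ℝ) (α : ℝ), 16 ≤ A.card → Transcendental ℚ α →
        c * A.card * (Real.log A.card) ^ ((4 : ℝ) / 3) /
            (Real.log (Real.log A.card)) ^ ((8 : ℝ) / 3)
          ≤ ((Finset.image₂ (fun a b => a + α * b) A A).card : ℝ) := by
  obtain ⟨m₀, hm₁, hm₀⟩ := kl_eventually
  have hm₁' : (1 : ℝ) ≤ m₀ := by exact_mod_cast hm₁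
  refine ⟨1 / (m₀ : ℝ) ^ 2, by positivity, fun A α hA hα => ?_⟩
  set S : ℝ := ((Finset.image₂ (fun a b => a + α * b) A A).card : ℝ) with hS
  set l := Real.log A.card with hl
  have hA16 : (16 : ℝ) ≤ A.card := by exact_mod_cast hA
  have hl1 : Real.exp 1 ≤ l := by
    have h1 : Real.log 16 ≤ l := Real.log_le_log (by norm_num) hA16
    have h2 : Real.log 16 = 4 * Real.log 2 := by
      rw [show (16 : ℝ) = 2 ^ 4 by norm_num, Real.log_pow]; norm_num
    have := Real.log_two_gt_d9
    have := Real.exp_one_lt_d9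
    linarith
  have hl2 : 1 ≤ l := by
    have := Real.exp_one_gt_d9
    linarith
  have hll : 1 ≤ Real.log l := by
    rw [Real.le_log_iff_exp_le (by linarith)]; exact hl1
  have hden : 1 ≤ Real.log l ^ ((8 : ℝ) / 3) := Real.one_le_rpow hll (by norm_num)
  have hnum : l ^ ((4 : ℝ) / 3) ≤ l ^ 2 := by
    rw [← Real.rpow_natCast]
    exact Real.rpow_le_rpow_of_exponent_le hl2 (by norm_num)
  have hc0 : (0 : ℝ) < 1 / (m₀ : ℝ) ^ 2 := by positivity
  have hc1 : 1 / (m₀ : ℝ) ^ 2 ≤ 1 := by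
    rw [div_le_one (by positivity)]
    exact one_le_pow₀ hm₁'
  have hmain : 1 / (m₀ : ℝ) ^ 2 * (l ^ 2 * A.card) ≤ S := by
    by_cases hm : m₀ ≤ ⌈l⌉₊
    · have h := kl_main m₀ hm₁ hm₀ A α hA hα hm
      have h0 : 0 ≤ l ^ 2 * A.card := by positivity
      calc _ ≤ 1 * (l ^ 2 * A.card) := by gcongr
        _ ≤ S := by rw [one_mul]; exact h
    · have hlm : l ≤ m₀ := (Nat.le_ceil l).trans (by exact_mod_cast (by omega : ⌈l⌉₊ ≤ m₀))
      have hAS : (A.card : ℝ) ≤ S := by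
        have hne : A.Nonempty := Finset.card_pos.1 (by omega)
        obtain ⟨b, hb⟩ := hne
        have := Finset.card_le_card_image₂_right (f := fun a b => a + α * b) (s := A) (t := A) hb
          (fun x y h => by simpa using h)
        rw [hS]
        exact_mod_cast this
      have h1 : l ^ 2 ≤ (m₀ : ℝ) ^ 2 := by gcongr
      calc 1 / (m₀ : ℝ) ^ 2 * (l ^ 2 * A.card) ≤ 1 / (m₀ : ℝ) ^ 2 * ((m₀ : ℝ) ^ 2 * A.card) := by
            gcongr
        _ = (A.card : ℝ) := by field_simp
        _ ≤ S := hAS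
  refine le_trans (div_le_self (by positivity) hden) ?_
  calc 1 / (m₀ : ℝ) ^ 2 * A.card * l ^ ((4 : ℝ) / 3) ≤ 1 / (m₀ : ℝ) ^ 2 * A.card * l ^ 2 := by
        gcongr
    _ = 1 / (m₀ : ℝ) ^ 2 * (l ^ 2 * A.card) := by ring
    _ ≤ S := hmain
end
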